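/- For every closed testable graphon property R there exists a testable graph property P such that P̄ = R. -/

import Mathlib

open MeasureTheory Filter Topology
open scoped ENNReal

noncomputable section

/-- The unit interval `[0,1]` as a subset of `ℝ`. -/
def I01 : Set ℝ := Set.Icc 0 1

/-- `W₀`: symmetric measurable functions `[0,1]² → [0,1]`
(represented as functions `ℝ → ℝ → ℝ`, with the relevant values on `[0,1]²`). -/
def IsGraphon (W : ℝ → ℝ → ℝ) : Prop :=
  Measurable (Function.uncurry W) ∧ (∀ x y, W x y = W y x) ∧
    ∀ x y, W x y ∈ Set.Icc (0 : ℝ) 1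

/-- The `L¹` norm of a kernel on `[0,1]²`. -/
def l1Norm (W : ℝ → ℝ → ℝ) : ℝ :=
  ∫ x in I01, ∫ y in I01, |W x y|

/-- The cut norm of a kernel on `[0,1]²`. -/
def cutNorm (W : ℝ → ℝ → ℝ) : ℝ :=
  sSup { r : ℝ | ∃ S T : Set ℝ, MeasurableSet S ∧ MeasurableSet T ∧ S ⊆ I01 ∧ T ⊆ I01 ∧
    r = |∫ x in S, ∫ y in T, W x y| }

/-- An invertible measure preserving map of `[0,1]`. -/
structure InvMP where
  toFun : ℝ → ℝ
  invFun : ℝ → ℝ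
  maps : ∀ x ∈ I01, toFun x ∈ I01
  mapsInv : ∀ x ∈ I01, invFun x ∈ I01
  measurePreserving :
    MeasurePreserving toFun (volume.restrict I01) (volume.restrict I01)
  measurePreservingInv :
    MeasurePreserving invFun (volume.restrict I01) (volume.restrict I01)
  leftInv : ∀ x ∈ I01, invFun (toFun x) = x
  rightInv : ∀ x ∈ I01, toFun (invFun x) = x

/-- `δ_□`: the cut distance, infimum of the cut norm over invertible measure
preserving transformations of `[0,1]`. -/
def deltaCut (U W : ℝ → ℝ → ℝ) : ℝ :=
  ⨅ φ : InvMP, cutNorm (fun x y => U x y - W (φ.toFun x) (φ.toFun y))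

/-- `δ₁`: the `L¹` distance minimized over invertible measure preserving
transformations of `[0,1]`. -/
def delta1 (U W : ℝ → ℝ → ℝ) : ℝ :=
  ⨅ φ : InvMP, l1Norm (fun x y => U x y - W (φ.toFun x) (φ.toFun y))



/-- A graph property: for each `n`, a set of simple graphs on `Fin n`. -/
def GraphProp := ∀ n : ℕ, Set (SimpleGraph (Fin n))

/-- Invariance under isomorphism (isomorphic graphs necessarily have the same
number of vertices). -/
def IsGraphProperty (P : GraphProp) : Prop :=
  ∀ (n : ℕ) (G H : SimpleGraph (Fin n)), Nonempty (G ≃g H) → (G ∈ P n ↔ H ∈ P n)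

/-- The normalized edit distance between graphs on a common vertex set. -/
def graphD1 {n : ℕ} (G H : SimpleGraph (Fin n)) : ℝ :=
  (symmDiff G.edgeSet H.edgeSet).ncard / (n ^ 2 : ℝ)

/-- The edit distance from a graph to a graph property (∞ if the property
contains no graph on the same number of nodes). -/
def graphD1P {n : ℕ} (G : SimpleGraph (Fin n)) (P : GraphProp) : ℝ≥0∞ :=
  ⨅ (H : SimpleGraph (Fin n)) (_ : H ∈ P n), ENNReal.ofReal (graphD1 G H)

open Classical in
/-- The step function `W_G` associated with a graph `G` on `{1,…,n}`:
its value on `((i−1)/n, i/n] × ((j−1)/n, j/n]` is `1` iff `ij ∈ E(G)`. -/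
def graphonOf {n : ℕ} (G : SimpleGraph (Fin n)) : ℝ → ℝ → ℝ := fun x y =>
  if ∃ i j : Fin n, G.Adj i j ∧ x ∈ Set.Ioc (((i : ℕ) : ℝ) / n) ((((i : ℕ) : ℝ) + 1) / n)
      ∧ y ∈ Set.Ioc (((j : ℕ) : ℝ) / n) ((((j : ℕ) : ℝ) + 1) / n)
  then 1 else 0

/-- `H` is (isomorphic to) an induced subgraph of `G`. -/
def IsInducedSubgraph {n k : ℕ} (G : SimpleGraph (Fin n)) (H : SimpleGraph (Fin k)) : Prop :=
  ∃ f : Fin k ↪ Fin n, ∀ i j, H.Adj i j ↔ G.Adj (f i) (f j)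

/-- The subgraph of `G` induced on the vertex subset `S` has property `P`
(as a graph on `k = |S|` nodes). -/
def inducedMem {n : ℕ} (G : SimpleGraph (Fin n)) (S : Finset (Fin n)) (k : ℕ)
    (P : GraphProp) : Prop :=
  ∃ H : SimpleGraph (Fin k), H ∈ P k ∧
    ∃ f : Fin k ↪ Fin n, (∀ i, f i ∈ S) ∧ ∀ i j, H.Adj i j ↔ G.Adj (f i) (f j)

/-- The number of `k`-element vertex subsets of `G` inducing a subgraph with property `P`. -/
def goodCount {n : ℕ} (G : SimpleGraph (Fin n)) (k : ℕ) (P : GraphProp) : ℕ :=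
  {S : Finset (Fin n) | S.card = k ∧ inducedMem G S k P}.ncard

/-- Testability of a graph property (Definition 1.1 of the paper). -/
def GraphTestable (P : GraphProp) : Prop :=
  ∃ P' : GraphProp, IsGraphProperty P' ∧
    (∀ (n : ℕ) (G : SimpleGraph (Fin n)), G ∈ P n → ∀ k, 1 ≤ k → k ≤ n →
      2 * n.choose k ≤ 3 * goodCount G k P') ∧
    (∀ ε : ℝ, 0 < ε → ∃ kε : ℕ, 1 ≤ kε ∧
      ∀ (n : ℕ) (G : SimpleGraph (Fin n)) (k : ℕ), kε ≤ k → k ≤ n →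
        ENNReal.ofReal ε ≤ graphD1P G P →
        3 * goodCount G k P' ≤ n.choose k)

def cube (k : ℕ) : Set (Fin k → ℝ) := Set.univ.pi fun _ => I01

open Classical in
/-- The homomorphism density `t(F,W)`. -/
def homDensity {k : ℕ} (F : SimpleGraph (Fin k)) (W : ℝ → ℝ → ℝ) : ℝ :=
  ∫ x in cube k, ∏ i : Fin k, ∏ j : Fin k,
    if i < j ∧ F.Adj i j then W (x i) (x j) else 1

open Classical in
/-- The induced density `t_ind(F,W)`. -/
def indDensity {k : ℕ} (F : SimpleGraph (Fin k)) (W : ℝ → ℝ → ℝ) : ℝ :=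
  ∫ x in cube k, ∏ i : Fin k, ∏ j : Fin k,
    if i < j then (if F.Adj i j then W (x i) (x j) else 1 - W (x i) (x j)) else 1

/-- Isomorphism of functions in `W₀`: equality of all homomorphism densities. -/
def GraphonIso (U W : ℝ → ℝ → ℝ) : Prop :=
  ∀ (k : ℕ) (F : SimpleGraph (Fin k)), homDensity F U = homDensity F W

open Classical in
/-- `P(G(k,W) ∈ R')`, the probability that the `W`-random graph on `k` nodes
has property `R'`. -/
def probIn (k : ℕ) (W : ℝ → ℝ → ℝ) (R' : GraphProp) : ℝ :=
  ∑ F : SimpleGraph (Fin k), if F ∈ R' k then indDensity F W else 0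

/-- The `L¹` distance from `W` to a set `R` of kernels, with value `∞` for `R = ∅`. -/
def d1SetE (W : ℝ → ℝ → ℝ) (R : Set (ℝ → ℝ → ℝ)) : ℝ≥0∞ :=
  ⨅ (U : ℝ → ℝ → ℝ) (_ : U ∈ R), ENNReal.ofReal (l1Norm fun x y => W x y - U x y)

/-- The cut-norm distance from `W` to a set `R` of kernels, with value `∞` for `R = ∅`. -/
def dCutSetE (W : ℝ → ℝ → ℝ) (R : Set (ℝ → ℝ → ℝ)) : ℝ≥0∞ :=
  ⨅ (U : ℝ → ℝ → ℝ) (_ : U ∈ R), ENNReal.ofReal (cutNorm fun x y => W x y - U x y)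

/-- The open ball `B₁(R,c)` (within `W₀`). -/
def ball1 (R : Set (ℝ → ℝ → ℝ)) (c : ℝ) : Set (ℝ → ℝ → ℝ) :=
  {W | IsGraphon W ∧ d1SetE W R < ENNReal.ofReal c}

/-- The open ball `B_□(R,c)` (within `W₀`). -/
def ballCut (R : Set (ℝ → ℝ → ℝ)) (c : ℝ) : Set (ℝ → ℝ → ℝ) :=
  {W | IsGraphon W ∧ dCutSetE W R < ENNReal.ofReal c}

/-- A graphon property: a set of graphons invariant under isomorphism. -/
def IsGraphonProperty (R : Set (ℝ → ℝ → ℝ)) : Prop :=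
  (∀ W ∈ R, IsGraphon W) ∧
    ∀ U W, IsGraphon U → IsGraphon W → GraphonIso U W → (U ∈ R ↔ W ∈ R)

/-- A set of graphons is closed if it is closed in the cut norm. -/
def CutClosed (R : Set (ℝ → ℝ → ℝ)) : Prop :=
  ∀ W, IsGraphon W →
    (∀ ε : ℝ, 0 < ε → ∃ U ∈ R, cutNorm (fun x y => W x y - U x y) < ε) → W ∈ R

/-- Testability of a graphon property. -/
def GraphonTestable (R : Set (ℝ → ℝ → ℝ)) : Prop :=
  ∃ R' : GraphProp, IsGraphProperty R' ∧
    (∀ W ∈ R, ∀ k : ℕ, 1 ≤ k → (2 : ℝ) / 3 ≤ probIn k W R') ∧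
    (∀ ε : ℝ, 0 < ε → ∃ kε : ℕ, 1 ≤ kε ∧ ∀ k, kε ≤ k → ∀ W, IsGraphon W →
      ENNReal.ofReal ε ≤ d1SetE W R → probIn k W R' ≤ 1 / 3)

/-- The closure `P̄` of a graph property: limits of convergent sequences
of graphs in `P` with sizes tending to infinity. -/
def closureP (P : GraphProp) : Set (ℝ → ℝ → ℝ) :=
  {W | IsGraphon W ∧ ∃ (n : ℕ → ℕ) (G : ∀ m, SimpleGraph (Fin (n m))),
    (∀ m, G m ∈ P (n m)) ∧ Tendsto n atTop atTop ∧
    Tendsto (fun m => deltaCut (graphonOf (G m)) W) atTop (nhds 0)}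

/-- A graph property is robust if graphs whose `W_G` is `d₁`-close to `P̄`
are themselves close to `P` in edit distance. -/
def Robust (P : GraphProp) : Prop :=
  ∀ ε : ℝ, 0 < ε → ∃ (N : ℕ) (ε' : ℝ), 1 ≤ N ∧ 0 < ε' ∧
    ∀ (n : ℕ), N ≤ n → ∀ G : SimpleGraph (Fin n),
      d1SetE (graphonOf G) (closureP P) ≤ ENNReal.ofReal ε' →
      graphD1P G P ≤ ENNReal.ofReal ε

/-- A hereditary graph property: closed under induced subgraphs. -/
def Hereditary (P : GraphProp) : Prop :=
  ∀ (n : ℕ) (G : SimpleGraph (Fin n)), G ∈ P n →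
    ∀ (k : ℕ) (H : SimpleGraph (Fin k)), IsInducedSubgraph G H → H ∈ P k

/-- `U` is a flexing of `W`: `U ∈ W₀` agrees with `W` wherever `W` takes value `0` or `1`. -/
def Flexing (U W : ℝ → ℝ → ℝ) : Prop :=
  IsGraphon U ∧ ∀ x y, (W x y = 0 ∨ W x y = 1) → U x y = W x y

/-- A function property is flexible if it is preserved under flexing. -/
def FlexibleFamily (R : Set (ℝ → ℝ → ℝ)) : Prop :=
  ∀ W ∈ R, ∀ U, Flexing U W → U ∈ R

/-- `U' ≤ W'` almost everywhere on `[0,1]²`. -/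
def aeLE (U W : ℝ → ℝ → ℝ) : Prop :=
  ∀ᵐ p ∂(volume.restrict (I01 ×ˢ I01)), U p.1 p.2 ≤ W p.1 p.2

/-- `U ⪯ W`: up to isomorphism, `U ≤ W` almost everywhere. -/
def graphonLE (U W : ℝ → ℝ → ℝ) : Prop :=
  ∃ U' W', IsGraphon U' ∧ IsGraphon W' ∧ GraphonIso U U' ∧ GraphonIso W W' ∧ aeLE U' W'

/-- The upward closure of a graph property: graphs having a spanning subgraph in `P`. -/
def upP (P : GraphProp) : GraphProp :=
  fun n => {G | ∃ H : SimpleGraph (Fin n), H ∈ P n ∧ H ≤ G}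

/-- The upward closure of a function property. -/
def upR (R : Set (ℝ → ℝ → ℝ)) : Set (ℝ → ℝ → ℝ) :=
  {W | IsGraphon W ∧ ∃ U ∈ R, graphonLE U W}

/-- A stepfunction: constant on the products of a finite measurable partition of `[0,1]`. -/
def IsStepfunction (W : ℝ → ℝ → ℝ) : Prop :=
  ∃ (m : ℕ) (S : Fin m → Set ℝ), (∀ i, MeasurableSet (S i)) ∧
    (⋃ i, S i) = I01 ∧ (∀ i j, i ≠ j → Disjoint (S i) (S j)) ∧
    ∀ i j : Fin m, ∀ x ∈ S i, ∀ x' ∈ S i, ∀ y ∈ S j, ∀ y' ∈ S j, W x y = W x' y'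

open Classical in
/-- A testable graphon functional: its value can be estimated from `W`-random graphs. -/
def TestableFunctional (f : (ℝ → ℝ → ℝ) → ℝ) : Prop :=
  ∃ g : ∀ n : ℕ, SimpleGraph (Fin n) → ℝ,
    (∀ (n : ℕ) (G H : SimpleGraph (Fin n)), Nonempty (G ≃g H) → g n G = g n H) ∧
    ∀ ε : ℝ, 0 < ε → ∃ kε : ℕ, 1 ≤ kε ∧ ∀ k, kε ≤ k → ∀ W, IsGraphon W →
      (∑ F : SimpleGraph (Fin k), if ε < |f W - g k F| then indDensity F W else 0) < 1 / 3


/-- Uniform measure on the unit interval. -/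
def lam : Measure ℝ := volume.restrict I01

instance lam_prob : IsProbabilityMeasure lam := ⟨by simp [lam, I01]⟩

lemma pi_precomp {ι κ : Type} [Fintype ι] [Fintype κ] (μ : ι → Measure ℝ)
    [∀ i, IsProbabilityMeasure (μ i)] (τ : κ → ι) (hτ : Function.Injective τ) :
    MeasurePreserving (fun ω : ι → ℝ => fun a => ω (τ a)) (Measure.pi μ)
      (Measure.pi fun a => μ (τ a)) := by
  refine ⟨by fun_prop, ?_⟩
  have h1 : ProbabilityTheory.iIndepFun (fun i (ω : ι → ℝ) => ω i) (Measure.pi μ) :=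
    ProbabilityTheory.iIndepFun_pi (X := fun i x => x) (fun i => aemeasurable_id)
  have h2 := h1.precomp hτ
  rw [ProbabilityTheory.iIndepFun_iff_map_fun_eq_pi_map (fun i => by
    exact (measurable_pi_apply _).aemeasurable)] at h2
  rw [h2]
  congr 1
  ext1 a
  exact (measurePreserving_eval μ (τ a)).map_eq

lemma pi_sum_split {κ κ' : Type} [Fintype κ] [Fintype κ'] (μ : κ → Measure ℝ) (μ' : κ' → Measure ℝ)
    [∀ i, IsProbabilityMeasure (μ i)] [∀ i, IsProbabilityMeasure (μ' i)] :
    MeasurePreserving (fun p : (κ → ℝ) × (κ' → ℝ) => (Sum.elim p.1 p.2 : κ ⊕ κ' → ℝ))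
      ((Measure.pi μ).prod (Measure.pi μ')) (Measure.pi (Sum.elim μ μ')) := by
  have : ∀ i, IsProbabilityMeasure (Sum.elim μ μ' i) := by
    rintro (i | i)
    · simp only [Sum.elim_inl]; infer_instance
    · simp only [Sum.elim_inr]; infer_instance
  have hm : Measurable (fun p : (κ → ℝ) × (κ' → ℝ) => (Sum.elim p.1 p.2 : κ ⊕ κ' → ℝ)) := by
    rw [measurable_pi_iff]
    rintro (i | i)
    · simp only [Sum.elim_inl]; fun_prop
    · simp only [Sum.elim_inr]; fun_prop
  refine ⟨hm, ?_⟩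
  symm
  apply Measure.pi_eq
  intro s hs
  rw [Measure.map_apply hm (MeasurableSet.univ_pi hs)]
  have : (fun p : (κ → ℝ) × (κ' → ℝ) => (Sum.elim p.1 p.2 : κ ⊕ κ' → ℝ)) ⁻¹' (Set.univ.pi s)
      = (Set.univ.pi fun i => s (Sum.inl i)) ×ˢ (Set.univ.pi fun i => s (Sum.inr i)) := by
    ext p
    simp [Set.mem_pi, Sum.forall]
  rw [this, Measure.prod_prod, Measure.pi_pi, Measure.pi_pi, Fintype.prod_sum_type]
  simp

lemma pi_resample {ι : Type} [Fintype ι] [DecidableEq ι] (μ : ι → Measure ℝ)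
    [∀ i, IsProbabilityMeasure (μ i)] (e : ι) :
    MeasurePreserving (fun p : (ι → ℝ) × ℝ => Function.update p.1 e p.2)
      ((Measure.pi μ).prod (μ e)) (Measure.pi μ) := by
  have hm : Measurable (fun p : (ι → ℝ) × ℝ => Function.update p.1 e p.2) := by
    rw [measurable_pi_iff]
    intro i
    by_cases h : i = e
    · subst h; simp only [Function.update_self]; fun_prop
    · simp only [Function.update_of_ne h]; fun_prop
  refine ⟨hm, ?_⟩
  symm
  apply Measure.pi_eq
  intro s hs
  rw [Measure.map_apply hm (MeasurableSet.univ_pi hs)]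
  have : (fun p : (ι → ℝ) × ℝ => Function.update p.1 e p.2) ⁻¹' (Set.univ.pi s)
      = (Set.univ.pi (Function.update s e Set.univ)) ×ˢ (s e) := by
    ext p
    simp only [Set.mem_preimage, Set.mem_pi, Set.mem_univ, true_imp_iff, Set.mem_prod]
    constructor
    · intro h
      refine ⟨fun i => ?_, by simpa using h e⟩
      by_cases hi : i = e
      · subst hi; simp
      · simpa [hi] using h i
    · rintro ⟨h, h'⟩ i
      by_cases hi : i = e
      · subst hi; simpa using h'
      · simpa [hi] using h i
  rw [this, Measure.prod_prod, Measure.pi_pi, ← Finset.mul_prod_erase Finset.univ _ (Finset.mem_univ e),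
    ← Finset.mul_prod_erase Finset.univ (fun i => μ i (s i)) (Finset.mem_univ e)]
  simp only [Function.update_self, measure_univ, one_mul]
  rw [mul_comm]
  congr 1
  apply Finset.prod_congr rfl
  intro i hi
  rw [Function.update_of_ne (Finset.ne_of_mem_erase hi)]

lemma integrable_bdd {α : Type*} [MeasurableSpace α] {μ : Measure α} [IsFiniteMeasure μ]
    {f : α → ℝ} (hf : Measurable f) (C : ℝ) (h : ∀ x, |f x| ≤ C) : Integrable f μ :=
  Integrable.of_bound hf.aestronglyMeasurable C (Eventually.of_forall h)

lemma integral_resample {ι : Type} [Fintype ι] [DecidableEq ι] (μ : ι → Measure ℝ)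
    [∀ i, IsProbabilityMeasure (μ i)] (e : ι) (f : (ι → ℝ) → ℝ) (hf : Measurable f) (C : ℝ)
    (h : ∀ x, |f x| ≤ C) :
    ∫ ω, f ω ∂(Measure.pi μ) = ∫ ω, ∫ t, f (Function.update ω e t) ∂(μ e) ∂(Measure.pi μ) := by
  have hp := pi_resample μ e
  rw [← hp.map_eq, integral_map hp.measurable.aemeasurable hf.aestronglyMeasurable, hp.map_eq,
    integral_prod]
  exact integrable_bdd (hf.comp hp.measurable) C (fun x => h _)

/-- Independence of disjoint blocks of coordinates. -/
lemma integral_indep {ι κ κ' : Type} [Fintype ι] [Fintype κ] [Fintype κ'] (μ : ι → Measure ℝ)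
    [∀ i, IsProbabilityMeasure (μ i)] (τ : κ → ι) (τ' : κ' → ι)
    (hτ : Function.Injective (Sum.elim τ τ')) (φ : (κ → ℝ) → ℝ) (ψ : (κ' → ℝ) → ℝ)
    (hφ : Measurable φ) (hψ : Measurable ψ) :
    ∫ ω, φ (fun a => ω (τ a)) * ψ (fun a => ω (τ' a)) ∂(Measure.pi μ)
      = (∫ x, φ x ∂(Measure.pi fun a => μ (τ a))) * ∫ x, ψ x ∂(Measure.pi fun a => μ (τ' a)) := by
  have h1 := pi_precomp μ _ hτ
  have h2 := pi_sum_split (fun a => μ (τ a)) (fun a => μ (τ' a))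
  have e : (Sum.elim (fun a => μ (τ a)) (fun a => μ (τ' a))) = fun a => μ (Sum.elim τ τ' a) := by
    ext1 a; cases a <;> rfl
  rw [e] at h2
  rw [← integral_prod_mul]
  have hm : Measurable fun ω : κ ⊕ κ' → ℝ => φ (fun a => ω (Sum.inl a)) * ψ (fun a => ω (Sum.inr a)) := by
    fun_prop
  have e1 := integral_map (μ := Measure.pi μ) h1.measurable.aemeasurable
    (hm.aestronglyMeasurable)
  have e2 := integral_map (μ := (Measure.pi fun a => μ (τ a)).prod (Measure.pi fun a => μ (τ' a)))
    h2.measurable.aemeasurable (hm.aestronglyMeasurable)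
  rw [h1.map_eq] at e1
  rw [h2.map_eq] at e2
  simp only [Sum.elim_inl, Sum.elim_inr] at e1 e2
  rw [← e1, e2]

/-- The `i`-th stratum of the unit interval. -/
def strat (n : ℕ) (i : Fin n) : Set ℝ :=
  Set.Ioc (((i : ℕ) : ℝ) / n) ((((i : ℕ) : ℝ) + 1) / n)

/-- Uniform measure on the `i`-th stratum. -/
def nu (n : ℕ) (i : Fin n) : Measure ℝ := (n : ℝ≥0∞) • volume.restrict (strat n i)

lemma fin_pos_real {n : ℕ} (i : Fin n) : (0 : ℝ) < n := by
  have := i.pos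
  exact_mod_cast this

lemma volume_strat {n : ℕ} (i : Fin n) : volume (strat n i) = (n : ℝ≥0∞)⁻¹ := by
  have := fin_pos_real i
  rw [strat, Real.volume_Ioc]
  have h : (((i : ℕ) : ℝ) + 1) / n - ((i : ℕ) : ℝ) / n = (n : ℝ)⁻¹ := by field_simp; ring
  rw [h, ENNReal.ofReal_inv_of_pos this, ENNReal.ofReal_natCast]

instance nu_prob (n : ℕ) (i : Fin n) : IsProbabilityMeasure (nu n i) := ⟨by
  have := i.pos
  simp only [nu, Measure.smul_apply, Measure.restrict_apply MeasurableSet.univ, Set.univ_inter,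
    volume_strat, smul_eq_mul]
  exact ENNReal.mul_inv_cancel (by exact_mod_cast this.ne') (by simp)⟩

lemma measurableSet_strat {n : ℕ} (i : Fin n) : MeasurableSet (strat n i) := measurableSet_Ioc

lemma nu_ae {n : ℕ} (i : Fin n) : ∀ᵐ x ∂(nu n i), x ∈ strat n i := by
  rw [nu]
  apply Measure.ae_smul_measure
  exact ae_restrict_mem (measurableSet_strat i)

lemma strat_unique {n : ℕ} {i j : Fin n} {x : ℝ} (hi : x ∈ strat n i) (hj : x ∈ strat n j) :
    i = j := by
  have hn := fin_pos_real i
  simp only [strat, Set.mem_Ioc, div_lt_iff₀ hn, le_div_iff₀ hn] at hi hj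
  have h1 : ((i : ℕ) : ℝ) < (j : ℕ) + 1 := by linarith
  have h2 : ((j : ℕ) : ℝ) < (i : ℕ) + 1 := by linarith
  have h1 : (i : ℕ) < (j : ℕ) + 1 := by exact_mod_cast h1
  have h2 : (j : ℕ) < (i : ℕ) + 1 := by exact_mod_cast h2
  ext; omega

lemma iUnion_strat {n : ℕ} (hn : 0 < n) : (⋃ i : Fin n, strat n i) = Set.Ioc 0 1 := by
  have hn' : (0 : ℝ) < n := by exact_mod_cast hn
  ext x
  simp only [Set.mem_iUnion, strat, Set.mem_Ioc]
  constructor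
  · rintro ⟨i, h1, h2⟩
    refine ⟨lt_of_le_of_lt (by positivity) h1, h2.trans ?_⟩
    rw [div_le_one hn']
    have := i.2
    exact_mod_cast this
  · rintro ⟨h1, h2⟩
    have hx : 0 < x * n := by positivity
    have hc : 0 < ⌈x * n⌉₊ := Nat.ceil_pos.2 hx
    have hc2 : ⌈x * n⌉₊ ≤ n := by
      rw [Nat.ceil_le]; nlinarith
    have hlt := Nat.ceil_lt_add_one hx.le
    have hle := Nat.le_ceil (x * n)
    refine ⟨⟨⌈x * n⌉₊ - 1, by omega⟩, ?_, ?_⟩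
    · rw [div_lt_iff₀ hn']
      simp only
      rw [Nat.cast_sub hc]; push_cast; linarith
    · rw [le_div_iff₀ hn']
      simp only
      rw [Nat.cast_sub hc]; push_cast; linarith

lemma lam_eq : lam = volume.restrict (Set.Ioc 0 1) := by
  rw [lam, I01]
  exact (Measure.restrict_congr_set Ioc_ae_eq_Icc).symm

lemma sum_nu {n : ℕ} (hn : 0 < n) : ∑ i, nu n i = (n : ℝ≥0∞) • lam := by
  simp only [nu]
  rw [← Finset.smul_sum, lam_eq, ← iUnion_strat hn]
  congr 1
  rw [Measure.restrict_iUnion (fun i j hij => ?_) measurableSet_strat, Measure.sum_fintype]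
  exact Set.disjoint_left.2 fun x h1 h2 => hij (strat_unique h1 h2)

lemma integral_lam_eq {n : ℕ} (hn : 0 < n) (g : ℝ → ℝ) (hg : Measurable g) (C : ℝ)
    (hC : ∀ x, |g x| ≤ C) :
    ∑ i, ∫ x, g x ∂(nu n i) = n * ∫ x, g x ∂lam := by
  rw [← integral_finsetSum_measure (fun i _ => integrable_bdd hg C hC), sum_nu hn,
    integral_smul_measure]
  simp

lemma integral_lam_eq₂ {n : ℕ} (hn : 0 < n) (g : ℝ → ℝ → ℝ) (hg : Measurable (Function.uncurry g))
    (C : ℝ) (hC : ∀ x y, |g x y| ≤ C) :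
    ∑ i, ∑ j, ∫ x, ∫ y, g x y ∂(nu n j) ∂(nu n i) = n ^ 2 * ∫ x, ∫ y, g x y ∂lam ∂lam := by
  have hbd : ∀ (μ : Measure ℝ) [IsProbabilityMeasure μ] x, |∫ y, g x y ∂μ| ≤ C := by
    intro μ _ x
    have := norm_integral_le_of_norm_le_const (μ := μ) (f := g x) (C := C) (Eventually.of_forall (hC x))
    simpa using this
  have hms : ∀ (μ : Measure ℝ) [IsProbabilityMeasure μ], Measurable fun x => ∫ y, g x y ∂μ := by
    intro μ _
    exact (hg.stronglyMeasurable.integral_prod_right (ν := μ)).measurable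
  have : ∀ i, ∑ j, ∫ x, ∫ y, g x y ∂(nu n j) ∂(nu n i) = n * ∫ x, ∫ y, g x y ∂lam ∂(nu n i) := by
    intro i
    rw [← integral_finsetSum _ (fun j _ => integrable_bdd (hms _) C (hbd _)), ← integral_const_mul]
    congr 1
    ext x
    exact integral_lam_eq hn (g x) hg.of_uncurry_left C (hC x)
  simp_rw [this]
  rw [← Finset.mul_sum, integral_lam_eq hn _ (hms _) C (hbd _)]
  ring

lemma sum_pi_nu {n : ℕ} (hn : 0 < n) (k : ℕ) :
    ∑ v : Fin k → Fin n, Measure.pi (fun a => nu n (v a))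
      = ((n : ℝ≥0∞) ^ k) • Measure.pi (fun _ : Fin k => lam) := by
  have h0 : (n : ℝ≥0∞) ≠ 0 := by exact_mod_cast hn.ne'
  have h1 : Measure.pi (fun _ : Fin k => lam) = ((n : ℝ≥0∞) ^ k)⁻¹ •
      ∑ v : Fin k → Fin n, Measure.pi (fun a => nu n (v a)) := by
    apply Measure.pi_eq
    intro s hs
    simp only [Measure.smul_apply, Measure.finsetSum_apply, Measure.pi_pi, smul_eq_mul]
    have : ∑ v : Fin k → Fin n, ∏ a, nu n (v a) (s a) = ∏ a, ∑ i, nu n i (s a) := by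
      rw [Finset.prod_univ_sum, Fintype.piFinset_univ]
    rw [this]
    have h2 : ∀ a, ∑ i, nu n i (s a) = n * lam (s a) := by
      intro a
      rw [← Measure.finsetSum_apply, sum_nu hn]; rfl
    simp_rw [h2]
    rw [Finset.prod_mul_distrib, Finset.prod_const, Finset.card_univ, Fintype.card_fin, ← mul_assoc,
      ENNReal.inv_mul_cancel (pow_ne_zero _ h0) (by simp), one_mul]
  rw [h1, smul_smul, ENNReal.mul_inv_cancel (pow_ne_zero _ h0) (by simp), one_smul]

lemma integral_pi_lam_eq {n : ℕ} (hn : 0 < n) (k : ℕ) (g : (Fin k → ℝ) → ℝ) (hg : Measurable g)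
    (C : ℝ) (hC : ∀ x, |g x| ≤ C) :
    ∑ v : Fin k → Fin n, ∫ x, g x ∂(Measure.pi fun a => nu n (v a))
      = n ^ k * ∫ x, g x ∂(Measure.pi fun _ : Fin k => lam) := by
  rw [← integral_finsetSum_measure (fun i _ => integrable_bdd hg C hC), sum_pi_nu hn,
    integral_smul_measure]
  simp

lemma cube_restrict (k : ℕ) :
    (volume : Measure (Fin k → ℝ)).restrict (cube k) = Measure.pi fun _ : Fin k => lam := by
  rw [cube, volume_pi, Measure.restrict_pi_pi]; rfl

lemma prod_sym2_eq {k : ℕ} (p : Sym2 (Fin k) → ℝ) (hp : ∀ e, e.IsDiag → p e = 1) :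
    ∏ e, p e = ∏ i : Fin k, ∏ j : Fin k, if i < j then p s(i, j) else 1 := by
  have h := Finset.sum_sym2_filter_not_isDiag (M := Additive ℝ) (Finset.univ : Finset (Fin k))
    (fun e => Additive.ofMul (p e))
  have h' : ∏ e ∈ (Finset.univ : Finset (Fin k)).sym2 with ¬ e.IsDiag, p e =
      ∏ i ∈ (Finset.univ : Finset (Fin k)).offDiag with i.1 < i.2, p s(i.1, i.2) := h
  rw [Finset.prod_filter, Finset.sym2_univ] at h'
  have e1 : ∏ e, p e = ∏ a : Sym2 (Fin k), if ¬a.IsDiag then p a else 1 := by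
    apply Finset.prod_congr rfl
    intro e _
    by_cases he : e.IsDiag
    · simp [he, hp e he]
    · simp [he]
  rw [e1, h', ← Finset.prod_product' (f := fun i j => if i < j then p s(i, j) else 1),
    Finset.prod_filter]
  refine Finset.prod_subset (fun x hx => by simp) ?_
  intro x _ hx
  simp only [Finset.mem_offDiag, Finset.mem_univ, true_and, ne_eq, not_not] at hx
  simp [hx]

/-- The graph determined by vertex positions and edge coins. -/
def gr {V : Type} (U : ℝ → ℝ → ℝ) (ω : V ⊕ Sym2 V → ℝ) : SimpleGraph V where
  Adj a b := a ≠ b ∧ ω (Sum.inr s(a, b)) ≤ U (ω (Sum.inl a)) (ω (Sum.inl b)) ∧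
    ω (Sum.inr s(a, b)) ≤ U (ω (Sum.inl b)) (ω (Sum.inl a))
  symm := by
    constructor
    intro a b h
    rw [Sym2.eq_swap]
    exact ⟨h.1.symm, h.2.2, h.2.1⟩
  loopless := by
    constructor
    intro a h
    exact h.1 rfl

lemma gr_adj {V : Type} {U : ℝ → ℝ → ℝ} (hU : IsGraphon U) (ω : V ⊕ Sym2 V → ℝ) (a b : V) :
    (gr U ω).Adj a b ↔ a ≠ b ∧ ω (Sum.inr s(a, b)) ≤ U (ω (Sum.inl a)) (ω (Sum.inl b)) := by
  simp only [gr]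
  rw [hU.2.1 (ω (Sum.inl b))]
  tauto

/-- Induced map on coordinates. -/
def tau {V V' : Type} (v : V → V') : V ⊕ Sym2 V → V' ⊕ Sym2 V' := Sum.map v (Sym2.map v)

lemma tau_inj {V V' : Type} {v : V → V'} (hv : Function.Injective v) :
    Function.Injective (tau v) := Function.Injective.sumMap hv (Sym2.map.injective hv)

lemma gr_comap {V V' : Type} (U : ℝ → ℝ → ℝ) (ω : V' ⊕ Sym2 V' → ℝ) {v : V → V'}
    (hv : Function.Injective v) : (gr U ω).comap v = gr U (fun a => ω (tau v a)) := by
  ext a b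
  simp [gr, tau, hv.ne_iff]

lemma measurable_graphon {α : Type*} [MeasurableSpace α] {U : ℝ → ℝ → ℝ} (hU : IsGraphon U)
    {f g : α → ℝ} (hf : Measurable f) (hg : Measurable g) : Measurable fun x => U (f x) (g x) :=
  hU.1.comp (hf.prodMk hg)

lemma gr_measurableSet {V : Type} [Fintype V] {U : ℝ → ℝ → ℝ} (hU : IsGraphon U)
    (A : Set (SimpleGraph V)) : MeasurableSet {ω | gr U ω ∈ A} := by
  classical
  have : {ω | gr U ω ∈ A} = ⋃ F ∈ A, ⋂ a : V, ⋂ b : V, {ω | (gr U ω).Adj a b ↔ F.Adj a b} := by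
    ext ω
    simp only [Set.mem_ofPred_eq, Set.mem_iUnion, Set.mem_iInter, exists_prop]
    constructor
    · intro h
      exact ⟨_, h, fun a b => Iff.rfl⟩
    · rintro ⟨F, hF, h⟩
      have : gr U ω = F := by ext a b; exact h a b
      rwa [this]
  rw [this]
  refine MeasurableSet.biUnion (Set.to_countable A) fun F _ => ?_
  refine MeasurableSet.iInter fun a => MeasurableSet.iInter fun b => ?_
  have hm : MeasurableSet {ω : V ⊕ Sym2 V → ℝ | (gr U ω).Adj a b} := by
    simp only [gr_adj hU]
    refine (MeasurableSet.const _).inter (measurableSet_le (measurable_pi_apply _) ?_)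
    exact measurable_graphon hU (measurable_pi_apply _) (measurable_pi_apply _)
  by_cases hF : F.Adj a b
  · simpa only [hF, iff_true] using hm
  · simp only [hF, iff_false]; exact hm.compl

open Classical in
/-- Indicator of a graph property. -/
def ind {V : Type} (A : Set (SimpleGraph V)) (G : SimpleGraph V) : ℝ := if G ∈ A then 1 else 0

lemma ind_nonneg {V : Type} (A : Set (SimpleGraph V)) (G : SimpleGraph V) : 0 ≤ ind A G := by
  unfold ind; split_ifs <;> norm_num

lemma ind_le_one {V : Type} (A : Set (SimpleGraph V)) (G : SimpleGraph V) : ind A G ≤ 1 := by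
  unfold ind; split_ifs <;> norm_num

lemma ind_abs {V : Type} (A : Set (SimpleGraph V)) (G : SimpleGraph V) : |ind A G| ≤ 1 := by
  rw [abs_of_nonneg (ind_nonneg A G)]; exact ind_le_one A G

lemma ind_gr_measurable {V : Type} [Fintype V] {U : ℝ → ℝ → ℝ} (hU : IsGraphon U)
    (A : Set (SimpleGraph V)) : Measurable fun ω => ind A (gr U ω) := by
  classical
  unfold ind
  exact Measurable.ite (gr_measurableSet hU A) measurable_const measurable_const

/-- Coordinate measures of the sampling model. -/
def smp {V : Type} (κ : V → Measure ℝ) : V ⊕ Sym2 V → Measure ℝ := Sum.elim κ (fun _ => lam)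

instance smp_prob {V : Type} (κ : V → Measure ℝ) [∀ i, IsProbabilityMeasure (κ i)] (i : V ⊕ Sym2 V) :
    IsProbabilityMeasure (smp κ i) := by
  cases i
  · simp only [smp, Sum.elim_inl]; infer_instance
  · simp only [smp, Sum.elim_inr]; infer_instance

open Classical in
/-- The integrand of `indDensity`. -/
def indKer {k : ℕ} (F : SimpleGraph (Fin k)) (W : ℝ → ℝ → ℝ) (x : Fin k → ℝ) : ℝ :=
  ∏ i : Fin k, ∏ j : Fin k,
    if i < j then (if F.Adj i j then W (x i) (x j) else 1 - W (x i) (x j)) else 1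

lemma indDensity_eq {k : ℕ} (F : SimpleGraph (Fin k)) (W : ℝ → ℝ → ℝ) :
    indDensity F W = ∫ x, indKer F W x ∂(Measure.pi fun _ : Fin k => lam) := by
  rw [indDensity, cube_restrict]; rfl

lemma indKer_measurable {k : ℕ} (F : SimpleGraph (Fin k)) {W : ℝ → ℝ → ℝ} (hW : IsGraphon W) :
    Measurable (indKer F W) := by
  unfold indKer
  refine Finset.measurable_prod _ fun i _ => Finset.measurable_prod _ fun j _ => ?_
  have := measurable_graphon hW (measurable_pi_apply (X := fun _ => ℝ) i) (measurable_pi_apply j)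
  split_ifs
  · exact this
  · exact measurable_const.sub this
  · exact measurable_const

lemma indKer_mem {k : ℕ} (F : SimpleGraph (Fin k)) {W : ℝ → ℝ → ℝ} (hW : IsGraphon W)
    (x : Fin k → ℝ) : 0 ≤ indKer F W x ∧ indKer F W x ≤ 1 := by
  classical
  have h : ∀ i j : Fin k, 0 ≤ (if i < j then (if F.Adj i j then W (x i) (x j) else 1 - W (x i) (x j)) else 1)
    ∧ (if i < j then (if F.Adj i j then W (x i) (x j) else 1 - W (x i) (x j)) else 1) ≤ 1 := by
    intro i j
    have := hW.2.2 (x i) (x j)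
    rw [Set.mem_Icc] at this
    split_ifs <;> constructor <;> linarith
  have e : indKer F W x = ∏ i : Fin k, ∏ j : Fin k,
    if i < j then (if F.Adj i j then W (x i) (x j) else 1 - W (x i) (x j)) else 1 := by
    unfold indKer
    refine Finset.prod_congr rfl fun i _ => Finset.prod_congr rfl fun j _ => ?_
    congr
  rw [e]
  constructor
  · exact Finset.prod_nonneg fun i _ => Finset.prod_nonneg fun j _ => (h i j).1
  · exact Finset.prod_le_one (fun i _ => Finset.prod_nonneg fun j _ => (h i j).1)
      fun i _ => Finset.prod_le_one (fun j _ => (h i j).1) fun j _ => (h i j).2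

lemma indKer_abs {k : ℕ} (F : SimpleGraph (Fin k)) {W : ℝ → ℝ → ℝ} (hW : IsGraphon W)
    (x : Fin k → ℝ) : |indKer F W x| ≤ 1 := by
  have := indKer_mem F hW x
  rw [abs_of_nonneg this.1]; exact this.2

lemma lam_le {u : ℝ} (hu : u ∈ Set.Icc (0:ℝ) 1) : lam.real (Set.Iic u) = u := by
  rw [lam, measureReal_restrict_apply measurableSet_Iic]
  have : Set.Iic u ∩ I01 = Set.Icc 0 u := by
    ext t; simp only [I01, Set.mem_inter_iff, Set.mem_Iic, Set.mem_Icc]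
    constructor
    · rintro ⟨a, b, c⟩; exact ⟨b, a⟩
    · rintro ⟨a, b⟩; exact ⟨b, a, b.trans hu.2⟩
  rw [this, Real.volume_real_Icc_of_le hu.1, sub_zero]

lemma lam_not_le {u : ℝ} (hu : u ∈ Set.Icc (0:ℝ) 1) : lam.real (Set.Iic u)ᶜ = 1 - u := by
  have := probReal_compl_eq_one_sub (μ := lam) (measurableSet_Iic :
    MeasurableSet (Set.Iic u))
  rw [lam_le hu] at this
  exact this

lemma gr_law_singleton {k : ℕ} (F : SimpleGraph (Fin k)) {U : ℝ → ℝ → ℝ} (hU : IsGraphon U)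
    (κ : Fin k → Measure ℝ) [∀ i, IsProbabilityMeasure (κ i)] :
    ∫ ω, ind {F} (gr U ω) ∂(Measure.pi (smp κ)) = ∫ x, indKer F U x ∂(Measure.pi κ) := by
  classical
  have hp := pi_sum_split κ (fun _ : Sym2 (Fin k) => lam)
  have hm := ind_gr_measurable hU {F}
  unfold smp
  rw [← hp.map_eq, integral_map hp.measurable.aemeasurable hm.aestronglyMeasurable, integral_prod]
  swap
  · exact integrable_bdd (hm.comp hp.measurable) 1 fun x => ind_abs _ _
  congr 1
  ext x
  let u : Sym2 (Fin k) → ℝ := Sym2.lift ⟨fun a b => U (x a) (x b), fun a b => hU.2.1 _ _⟩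
  let A : Sym2 (Fin k) → Set ℝ := fun e =>
    if e.IsDiag then Set.univ else if e ∈ F.edgeSet then Set.Iic (u e) else (Set.Iic (u e))ᶜ
  have hu : ∀ e, u e ∈ Set.Icc (0:ℝ) 1 := by
    intro e
    induction e using Sym2.ind with
    | _ a b => exact hU.2.2 _ _
  have hA : ∀ e, MeasurableSet (A e) := by
    intro e
    have h1 : MeasurableSet (Set.Iic (u e)) := measurableSet_Iic
    simp only [A]
    split_ifs
    · exact MeasurableSet.univ
    · exact h1
    · exact h1.compl
  have h1 : (fun c : Sym2 (Fin k) → ℝ => ind {F} (gr U (Sum.elim x c)))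
      = (Set.univ.pi A).indicator 1 := by
    ext c
    simp only [ind, Set.indicator, Set.mem_singleton_iff, Pi.one_apply]
    congr 1
    rw [eq_iff_iff]
    simp only [Set.mem_pi, Set.mem_univ, true_imp_iff]
    constructor
    · intro h e
      induction e using Sym2.ind with
      | _ a b =>
        simp only [A, Sym2.mk_isDiag_iff, SimpleGraph.mem_edgeSet, ← h, gr_adj hU]
        by_cases hab : a = b
        · simp [hab]
        · simp only [hab, if_false, u, Sym2.lift_mk, Sum.elim_inl, Sum.elim_inr, ne_eq,
            not_false_eq_true, true_and]
          split_ifs with hh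
          · exact hh
          · exact hh
    · intro h
      ext a b
      have := h s(a, b)
      rw [gr_adj hU]
      by_cases hab : a = b
      · simp [hab]
      · simp only [A, Sym2.mk_isDiag_iff, SimpleGraph.mem_edgeSet, hab, if_false] at this
        simp only [ne_eq, hab, not_false_eq_true, true_and, Sum.elim_inl, Sum.elim_inr]
        by_cases hF : F.Adj a b
        · simp only [hF, if_true] at this; simp only [hF, iff_true]; exact this
        · simp only [hF, if_false] at this; simp only [hF, iff_false]; exact this
  rw [h1, integral_indicator_one (MeasurableSet.univ_pi hA), measureReal_def, Measure.pi_pi,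
    ENNReal.toReal_prod, prod_sym2_eq]
  · unfold indKer
    refine Finset.prod_congr rfl fun i _ => Finset.prod_congr rfl fun j _ => ?_
    by_cases hij : i < j
    · simp only [hij, if_true, A, Sym2.mk_isDiag_iff, hij.ne, if_false, SimpleGraph.mem_edgeSet]
      by_cases hF : F.Adj i j
      · simp only [hF, if_true]; exact lam_le (hu s(i, j))
      · simp only [hF, if_false]; exact lam_not_le (hu s(i, j))
    · simp [hij]
  · intro e he
    simp [A, he]

lemma ind_eq_sum {V : Type} [Fintype V] [Fintype (SimpleGraph V)] (A : Set (SimpleGraph V))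
    (G : SimpleGraph V) : ind A G = ∑ F, ind A F * ind {F} G := by
  classical
  rw [Finset.sum_eq_single G]
  · simp [ind]
  · intro F _ hF
    simp [ind, hF.symm]
  · simp

lemma gr_law {k : ℕ} (A : Set (SimpleGraph (Fin k))) {U : ℝ → ℝ → ℝ} (hU : IsGraphon U)
    (κ : Fin k → Measure ℝ) [∀ i, IsProbabilityMeasure (κ i)] :
    ∫ ω, ind A (gr U ω) ∂(Measure.pi (smp κ)) =
      ∫ x, ∑ F, ind A F * indKer F U x ∂(Measure.pi κ) := by
  classical
  have h0 : (fun ω : Fin k ⊕ Sym2 (Fin k) → ℝ => ind A (gr U ω)) =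
      fun ω => ∑ F, ind A F * ind {F} (gr U ω) := by
    ext ω; rw [ind_eq_sum A]
  rw [h0, integral_finsetSum, integral_finsetSum]
  · refine Finset.sum_congr rfl fun F _ => ?_
    rw [integral_const_mul, integral_const_mul, gr_law_singleton F hU κ]
  · intro F _
    exact (integrable_bdd (indKer_measurable F hU) 1 (indKer_abs F hU)).const_mul _
  · intro F _
    exact (integrable_bdd (ind_gr_measurable hU _) 1 (fun _ => ind_abs _ _)).const_mul _

lemma probIn_eq {k : ℕ} {U : ℝ → ℝ → ℝ} (hU : IsGraphon U) (R' : GraphProp) :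
    probIn k U R' = ∫ x, ∑ F, ind (R' k) F * indKer F U x ∂(Measure.pi fun _ : Fin k => lam) := by
  classical
  rw [integral_finsetSum]
  · unfold probIn
    refine Finset.sum_congr rfl fun F _ => ?_
    rw [integral_const_mul, indDensity_eq, ind]
    split_ifs <;> simp
  · intro F _
    exact (integrable_bdd (indKer_measurable F hU) 1 (indKer_abs F hU)).const_mul _

lemma sum_indKer_measurable {k : ℕ} (A : Set (SimpleGraph (Fin k))) {U : ℝ → ℝ → ℝ}
    (hU : IsGraphon U) : Measurable fun x => ∑ F, ind A F * indKer F U x :=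
  Finset.measurable_sum _ fun F _ => (indKer_measurable F hU).const_mul _

lemma sum_indKer_abs {k : ℕ} (A : Set (SimpleGraph (Fin k))) {U : ℝ → ℝ → ℝ}
    (hU : IsGraphon U) (x : Fin k → ℝ) : |∑ F, ind A F * indKer F U x| ≤
      Fintype.card (SimpleGraph (Fin k)) := by
  refine (Finset.abs_sum_le_sum_abs _ _).trans ?_
  have : ∀ F ∈ (Finset.univ : Finset (SimpleGraph (Fin k))), |ind A F * indKer F U x| ≤ 1 := by
    intro F _
    rw [abs_mul]
    exact mul_le_one₀ (ind_abs _ _) (abs_nonneg _) (indKer_abs F hU x)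
  refine (Finset.sum_le_sum this).trans ?_
  simp

/-- Expected acceptance for a stratified sample with strata `v`. -/
def qv {n k : ℕ} (A : Set (SimpleGraph (Fin k))) (U : ℝ → ℝ → ℝ) (v : Fin k → Fin n) : ℝ :=
  ∫ ω, ind A (gr U ω) ∂(Measure.pi (smp fun a => nu n (v a)))

lemma integral_mem_unit {α : Type*} [MeasurableSpace α] (μ : Measure α) [IsProbabilityMeasure μ]
    (f : α → ℝ) (h0 : ∀ x, 0 ≤ f x) (h1 : ∀ x, f x ≤ 1) : 0 ≤ ∫ x, f x ∂μ ∧ ∫ x, f x ∂μ ≤ 1 := by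
  refine ⟨integral_nonneg h0, ?_⟩
  have := norm_integral_le_of_norm_le_const (μ := μ) (f := f) (C := 1) (Eventually.of_forall fun x => by
    rw [Real.norm_eq_abs, abs_of_nonneg (h0 x)]; exact h1 x)
  simp only [probReal_univ, mul_one] at this
  exact (le_abs_self _).trans this

lemma qv_mem {n k : ℕ} (A : Set (SimpleGraph (Fin k))) (U : ℝ → ℝ → ℝ) (v : Fin k → Fin n) :
    0 ≤ qv A U v ∧ qv A U v ≤ 1 :=
  integral_mem_unit _ _ (fun _ => ind_nonneg _ _) (fun _ => ind_le_one _ _)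

lemma sum_qv {n k : ℕ} (hn : 0 < n) {U : ℝ → ℝ → ℝ} (hU : IsGraphon U) (R' : GraphProp) :
    ∑ v : Fin k → Fin n, qv (R' k) U v = n ^ k * probIn k U R' := by
  rw [probIn_eq hU, ← integral_pi_lam_eq hn k _ (sum_indKer_measurable _ hU) _ (sum_indKer_abs _ hU)]
  refine Finset.sum_congr rfl fun v _ => ?_
  exact gr_law _ hU _

lemma probIn_mem {k : ℕ} {U : ℝ → ℝ → ℝ} (hU : IsGraphon U) (R' : GraphProp) :
    0 ≤ probIn k U R' ∧ probIn k U R' ≤ 1 := by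
  rw [probIn_eq hU, ← gr_law _ hU]
  exact integral_mem_unit _ _ (fun _ => ind_nonneg _ _) (fun _ => ind_le_one _ _)

/-- Fraction of tuples inducing a graph in `A`. -/
def frac {n k : ℕ} (A : Set (SimpleGraph (Fin k))) (G : SimpleGraph (Fin n)) : ℝ :=
  (∑ v : Fin k → Fin n, ind A (G.comap v)) / n ^ k

lemma graphonOf_strat {n : ℕ} (G : SimpleGraph (Fin n)) {i j : Fin n} {x y : ℝ}
    (hx : x ∈ strat n i) (hy : y ∈ strat n j) :
    graphonOf G x y = ind {H : SimpleGraph (Fin n) | H.Adj i j} G := by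
  classical
  unfold graphonOf ind
  congr 1
  rw [eq_iff_iff]
  constructor
  · rintro ⟨i', j', h, hx', hy'⟩
    have e1 := strat_unique hx hx'
    have e2 := strat_unique hy hy'
    subst e1 e2
    exact h
  · intro h
    exact ⟨i, j, h, hx, hy⟩

lemma graphonOf_isGraphon {n : ℕ} (G : SimpleGraph (Fin n)) : IsGraphon (graphonOf G) := by
  classical
  refine ⟨?_, ?_, ?_⟩
  · unfold graphonOf Function.uncurry
    refine Measurable.ite ?_ measurable_const measurable_const
    have : {a : ℝ × ℝ | ∃ i j : Fin n, G.Adj i j ∧ a.1 ∈ strat n i ∧ a.2 ∈ strat n j} =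
      ⋃ i : Fin n, ⋃ j : Fin n, ⋃ _ : G.Adj i j, (strat n i ×ˢ strat n j) := by
      ext a; simp only [Set.mem_ofPred_eq, Set.mem_iUnion, Set.mem_prod, exists_prop]
    have h2 : MeasurableSet {a : ℝ × ℝ | ∃ i j : Fin n, G.Adj i j ∧ a.1 ∈ strat n i ∧ a.2 ∈ strat n j} := by
      rw [this]
      exact MeasurableSet.iUnion fun i => MeasurableSet.iUnion fun j => MeasurableSet.iUnion fun _ =>
        (measurableSet_strat i).prod (measurableSet_strat j)
    exact h2
  · intro x y
    unfold graphonOf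
    congr 1
    rw [eq_iff_iff]
    constructor
    · rintro ⟨i, j, h, hx, hy⟩; exact ⟨j, i, h.symm, hy, hx⟩
    · rintro ⟨i, j, h, hx, hy⟩; exact ⟨j, i, h.symm, hy, hx⟩
  · intro x y
    unfold graphonOf
    split_ifs <;> simp

lemma indKer_graphonOf {n k : ℕ} (G : SimpleGraph (Fin n)) (F : SimpleGraph (Fin k))
    (v : Fin k → Fin n) (x : Fin k → ℝ) (hx : ∀ a, x a ∈ strat n (v a)) :
    indKer F (graphonOf G) x = ind {F} (G.comap v) := by
  classical
  unfold indKer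
  simp_rw [fun i j => graphonOf_strat G (hx i) (hx j)]
  by_cases h : G.comap v = F
  · have h0 : ind {F} (G.comap v) = 1 := by simp [ind, h]
    rw [h0]
    refine Finset.prod_eq_one fun i _ => Finset.prod_eq_one fun j _ => ?_
    have : F.Adj i j ↔ G.Adj (v i) (v j) := by rw [← h]; rfl
    simp only [ind, this, Set.mem_ofPred_eq]
    split_ifs <;> simp
  · have h0 : ind {F} (G.comap v) = 0 := by simp [ind, h]
    rw [h0]
    have : ∃ i j, i < j ∧ ¬ (F.Adj i j ↔ G.Adj (v i) (v j)) := by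
      by_contra hcon
      push Not at hcon
      apply h
      ext a b
      rw [SimpleGraph.comap_adj]
      rcases lt_trichotomy a b with hab | hab | hab
      · exact (hcon a b hab).symm
      · subst hab; simp
      · rw [G.adj_comm, F.adj_comm]; exact (hcon b a hab).symm
    obtain ⟨i, j, hij, hF⟩ := this
    refine Finset.prod_eq_zero (Finset.mem_univ i) (Finset.prod_eq_zero (Finset.mem_univ j) ?_)
    simp only [hij, if_true, ind, Set.mem_ofPred_eq]
    by_cases h1 : F.Adj i j
    · have h2 : ¬ G.Adj (v i) (v j) := by tauto
      simp [h1, h2]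
    · have h2 : G.Adj (v i) (v j) := by tauto
      simp [h1, h2]

lemma probIn_graphonOf {n k : ℕ} (hn : 0 < n) (G : SimpleGraph (Fin n)) (R' : GraphProp) :
    probIn k (graphonOf G) R' = frac (R' k) G := by
  have hG := graphonOf_isGraphon G
  have hn' : (0 : ℝ) < n := by exact_mod_cast hn
  rw [frac, eq_div_iff (by positivity), mul_comm, ← sum_qv hn hG]
  refine Finset.sum_congr rfl fun v _ => ?_
  rw [qv, gr_law _ hG]
  have : (fun x => ∑ F, ind (R' k) F * indKer F (graphonOf G) x)
      =ᵐ[Measure.pi fun a => nu n (v a)] fun _ => ind (R' k) (G.comap v) := by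
    have h1 : ∀ᵐ x ∂(Measure.pi fun a => nu n (v a)), ∀ a, x a ∈ strat n (v a) := by
      rw [eventually_all]
      intro a
      have h2 := measurePreserving_eval (fun a => nu n (v a)) a
      exact h2.quasiMeasurePreserving.ae (nu_ae (v a))
    filter_upwards [h1] with x hx
    rw [ind_eq_sum (R' k) (G.comap v)]
    exact Finset.sum_congr rfl fun F _ => by rw [indKer_graphonOf G F v x hx]
  rw [integral_congr_ae this]
  simp

lemma frac_mem {n k : ℕ} (A : Set (SimpleGraph (Fin k))) (G : SimpleGraph (Fin n)) :
    0 ≤ frac A G ∧ frac A G ≤ 1 := by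
  constructor
  · exact div_nonneg (Finset.sum_nonneg fun _ _ => ind_nonneg _ _) (by positivity)
  · apply div_le_one_of_le₀ _ (by positivity)
    refine (Finset.sum_le_sum fun v _ => ind_le_one _ _).trans ?_
    simp

lemma frac_iso {n k : ℕ} (A : Set (SimpleGraph (Fin k))) {G H : SimpleGraph (Fin n)}
    (e : G ≃g H) : frac A G = frac A H := by
  unfold frac
  congr 1
  refine Fintype.sum_equiv (Equiv.arrowCongr (Equiv.refl _) e.toEquiv) _ _ fun v => ?_
  congr 1
  ext a b
  exact e.map_adj_iff.symm

open Classical in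
/-- Number of non-injective maps. -/
def nonInj (κ : Type) [Fintype κ] (n : ℕ) : ℕ :=
  (Finset.univ.filter fun w : κ → Fin n => ¬ Function.Injective w).card

lemma nonInj_le (κ : Type) [Fintype κ] (n : ℕ) :
    n * nonInj κ n ≤ (Fintype.card κ) ^ 2 * n ^ Fintype.card κ := by
  classical
  have h1 : (Finset.univ.filter fun w : κ → Fin n => ¬ Function.Injective w) ⊆
      (Finset.univ : Finset (κ × κ)).biUnion fun p =>
        Finset.univ.filter fun w : κ → Fin n => p.1 ≠ p.2 ∧ w p.1 = w p.2 := by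
    intro w hw
    replace hw := (Finset.mem_filter.1 hw).2
    unfold Function.Injective at hw
    push Not at hw
    obtain ⟨a, b, h1, h2⟩ := hw
    simp only [Finset.mem_biUnion, Finset.mem_univ, true_and, Finset.mem_filter]
    exact ⟨(a, b), h2, h1⟩
  have h2 : ∀ p ∈ (Finset.univ : Finset (κ × κ)), n * (Finset.univ.filter fun w : κ → Fin n => p.1 ≠ p.2 ∧ w p.1 = w p.2).card
      ≤ n ^ Fintype.card κ := by
    intro p _
    have e1 : n * (Finset.univ.filter fun w : κ → Fin n => p.1 ≠ p.2 ∧ w p.1 = w p.2).card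
      = ((Finset.univ : Finset (Fin n)) ×ˢ (Finset.univ.filter fun w : κ → Fin n => p.1 ≠ p.2 ∧ w p.1 = w p.2)).card := by
      rw [Finset.card_product]; simp
    have e2 : n ^ Fintype.card κ = (Finset.univ : Finset (κ → Fin n)).card := by simp
    rw [e1, e2]
    refine Finset.card_le_card_of_injOn (fun q => Function.update q.2 p.2 q.1) (fun _ _ => by simp) ?_
    rintro ⟨t, w⟩ hw ⟨t', w'⟩ hw' heq
    simp only [Finset.coe_product, Set.mem_prod, Finset.mem_coe, Finset.mem_filter, Finset.mem_univ,
      true_and] at hw hw'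
    simp only at heq
    have ht : t = t' := by simpa using congrFun heq p.2
    have hoff : ∀ c, c ≠ p.2 → w c = w' c := by
      intro c hc
      simpa [hc] using congrFun heq c
    rw [Prod.mk.injEq]
    refine ⟨ht, funext fun c => ?_⟩
    by_cases hc : c = p.2
    · rw [hc, ← hw.2, ← hw'.2]; exact hoff _ hw.1
    · exact hoff c hc
  unfold nonInj
  calc n * (Finset.univ.filter fun w : κ → Fin n => ¬ Function.Injective w).card
      ≤ n * ∑ p : κ × κ, (Finset.univ.filter fun w : κ → Fin n => p.1 ≠ p.2 ∧ w p.1 = w p.2).card := by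
        gcongr
        exact (Finset.card_le_card h1).trans Finset.card_biUnion_le
    _ = ∑ p : κ × κ, n * (Finset.univ.filter fun w : κ → Fin n => p.1 ≠ p.2 ∧ w p.1 = w p.2).card := by
        rw [Finset.mul_sum]
    _ ≤ ∑ p : κ × κ, n ^ Fintype.card κ := Finset.sum_le_sum h2
    _ = _ := by simp [sq]

lemma second_moment {j n : ℕ} (e : (Fin j → Fin n) → (Fin j → Fin n) → ℝ) (q : (Fin j → Fin n) → ℝ)
    (μ c : ℝ) (hn : 0 < n) (hc : 0 ≤ c)
    (hq : ∀ v, |q v - μ| ≤ 1) (hsum : ∑ v, (q v - μ) = 0) (he : ∀ v v', e v v' ≤ 1)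
    (hg : ∀ v v', Function.Injective (Sum.elim v v') → e v v' ≤ (q v - μ) * (q v' - μ) + c) :
    ∑ v, ∑ v', e v v' ≤ (8 * j ^ 2 / n + c) * (n ^ j) ^ 2 := by
  classical
  have h1 : ∀ v v', e v v' ≤ (q v - μ) * (q v' - μ) + c +
      (if Function.Injective (Sum.elim v v') then 0 else 2) := by
    intro v v'
    split_ifs with h
    · simpa using hg v v' h
    · have := abs_le.1 (show |(q v - μ) * (q v' - μ)| ≤ 1 by
        rw [abs_mul]; exact mul_le_one₀ (hq v) (abs_nonneg _) (hq v'))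
      have := he v v'
      linarith
  have h2 : ∑ v : Fin j → Fin n, ∑ v' : Fin j → Fin n,
      (if Function.Injective (Sum.elim v v') then (0 : ℝ) else 2) = 2 * nonInj (Fin j ⊕ Fin j) n := by
    rw [← Finset.sum_product', Finset.univ_product_univ]
    have hh := Fintype.sum_equiv (Equiv.sumArrowEquivProdArrow (Fin j) (Fin j) (Fin n)).symm
        (fun p : (Fin j → Fin n) × (Fin j → Fin n) =>
          if Function.Injective (Sum.elim p.1 p.2) then (0 : ℝ) else 2)
        (fun w => if Function.Injective w then (0 : ℝ) else 2) (fun p => rfl)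
    rw [hh]
    unfold nonInj
    rw [Finset.card_filter]
    push_cast
    rw [Finset.mul_sum]
    refine Finset.sum_congr (by ext; simp) fun w _ => ?_
    split_ifs <;> norm_num
  have hn' : (0 : ℝ) < n := by exact_mod_cast hn
  have h3 : (nonInj (Fin j ⊕ Fin j) n : ℝ) ≤ 4 * j ^ 2 / n * (n ^ j) ^ 2 := by
    have := nonInj_le (Fin j ⊕ Fin j) n
    simp only [Fintype.card_sum, Fintype.card_fin] at this
    have h : ((n * nonInj (Fin j ⊕ Fin j) n : ℕ) : ℝ) ≤ (((j + j) ^ 2 * n ^ (j + j) : ℕ) : ℝ) := by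
      exact_mod_cast this
    push_cast at h
    rw [div_mul_eq_mul_div, le_div_iff₀ hn']
    calc (nonInj (Fin j ⊕ Fin j) n : ℝ) * n = n * nonInj (Fin j ⊕ Fin j) n := by ring
      _ ≤ _ := h
      _ = _ := by rw [pow_add]; ring
  calc ∑ v, ∑ v', e v v' ≤ ∑ v, ∑ v', ((q v - μ) * (q v' - μ) + c +
      (if Function.Injective (Sum.elim v v') then 0 else 2)) :=
        Finset.sum_le_sum fun v _ => Finset.sum_le_sum fun v' _ => h1 v v'
    _ = (∑ v, (q v - μ)) * (∑ v, (q v - μ)) + c * (n ^ j) ^ 2 + 2 * nonInj (Fin j ⊕ Fin j) n := by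
        simp only [Finset.sum_add_distrib]
        rw [h2, Finset.sum_mul_sum]
        simp
        ring
    _ ≤ _ := by
        rw [hsum]
        have : (8 * (j:ℝ) ^ 2 / n + c) * (n ^ j) ^ 2 = 2 * (4 * j ^ 2 / n * (n ^ j) ^ 2) + c * (n ^ j) ^ 2 := by
          ring
        rw [this]
        linarith

lemma abs_sub_le_one {a b : ℝ} (ha : 0 ≤ a ∧ a ≤ 1) (hb : 0 ≤ b ∧ b ≤ 1) : |a - b| ≤ 1 := by
  rw [abs_le]; constructor <;> linarith [ha.1, ha.2, hb.1, hb.2]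

lemma sum_frac_sub {n k : ℕ} (hn : 0 < n) (A : Set (SimpleGraph (Fin k))) (G : SimpleGraph (Fin n)) (μ : ℝ) :
    frac A G - μ = (∑ v : Fin k → Fin n, (ind A (G.comap v) - μ)) / n ^ k := by
  have hn' : (0 : ℝ) < n := by exact_mod_cast hn
  rw [Finset.sum_sub_distrib, frac, sub_div]
  congr 1
  simp
  field_simp

lemma frac_sub_sq {n k : ℕ} (hn : 0 < n) (A : Set (SimpleGraph (Fin k))) (G : SimpleGraph (Fin n)) (μ : ℝ) :
    (frac A G - μ) ^ 2 = (∑ v : Fin k → Fin n, ∑ v' : Fin k → Fin n,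
      (ind A (G.comap v) - μ) * (ind A (G.comap v') - μ)) / (n ^ k) ^ 2 := by
  rw [sum_frac_sub hn, div_pow, sq, Finset.sum_mul_sum]

lemma sumElim_parts {V κ κ' : Type} {v : κ → V} {v' : κ' → V}
    (h : Function.Injective (Sum.elim v v')) :
    Function.Injective v ∧ Function.Injective v' ∧ ∀ a b, v a ≠ v' b := by
  refine ⟨fun a b hab => ?_, fun a b hab => ?_, fun a b hab => ?_⟩
  · exact Sum.inl_injective (h (a₁ := Sum.inl a) (a₂ := Sum.inl b) hab)
  · exact Sum.inr_injective (h (a₁ := Sum.inr a) (a₂ := Sum.inr b) hab)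
  · exact absurd (h (a₁ := Sum.inl a) (a₂ := Sum.inr b) hab) (by simp)

lemma tau_disj {V κ κ' : Type} {v : κ → V} {v' : κ' → V} (h : Function.Injective (Sum.elim v v')) :
    Function.Injective (Sum.elim (tau v) (tau v')) := by
  obtain ⟨h1, h2, h3⟩ := sumElim_parts h
  refine Function.Injective.sumElim (tau_inj h1) (tau_inj h2) ?_
  rintro (a | a) (b | b) <;> simp only [tau, Sum.map_inl, Sum.map_inr, ne_eq, Sum.inl.injEq, Sum.inr.injEq, reduceCtorEq, not_false_eq_true]
  · exact h3 a b
  · induction a using Sym2.ind with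
    | _ a a' =>
      induction b using Sym2.ind with
      | _ b b' =>
        simp only [Sym2.map_mk, Sym2.eq_iff, not_or, not_and]
        exact ⟨fun hh => absurd hh (h3 _ _), fun hh => absurd hh (h3 _ _)⟩

/-- The stratified sampling measure. -/
def SM (n : ℕ) : Measure (Fin n ⊕ Sym2 (Fin n) → ℝ) := Measure.pi (smp (nu n))

instance SM_prob (n : ℕ) : IsProbabilityMeasure (SM n) := by unfold SM; infer_instance

lemma smp_tau {n k : ℕ} (v : Fin k → Fin n) :
    (fun a => smp (nu n) (tau v a)) = smp fun a => nu n (v a) := by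
  ext1 a; cases a <;> rfl

lemma ind_comap_measurable {n k : ℕ} (A : Set (SimpleGraph (Fin k))) {U : ℝ → ℝ → ℝ} (hU : IsGraphon U)
    (v : Fin k → Fin n) : Measurable fun ω => ind A ((gr U ω).comap v) := by
  exact ind_gr_measurable hU {G | G.comap v ∈ A}

lemma frac_gr_measurable {n k : ℕ} (A : Set (SimpleGraph (Fin k))) {U : ℝ → ℝ → ℝ} (hU : IsGraphon U) :
    Measurable fun ω : Fin n ⊕ Sym2 (Fin n) → ℝ => frac A (gr U ω) := by
  unfold frac
  exact (Finset.measurable_sum _ fun v _ => ind_comap_measurable A hU v).div_const _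

/-- Concentration for the stratified sample. -/
lemma strat_variance {n j : ℕ} (hn : 0 < n) {U : ℝ → ℝ → ℝ} (hU : IsGraphon U) (R' : GraphProp) :
    ∫ ω, (frac (R' j) (gr U ω) - probIn j U R') ^ 2 ∂(SM n) ≤ 8 * j ^ 2 / n := by
  have hn' : (0 : ℝ) < n := by exact_mod_cast hn
  set μ := probIn j U R' with hμ
  have hμm := probIn_mem (k := j) hU R'
  simp_rw [frac_sub_sq hn]
  have hi : ∀ v v' : Fin j → Fin n, Integrable (fun ω => (ind (R' j) ((gr U ω).comap v) - μ) *
      (ind (R' j) ((gr U ω).comap v') - μ)) (SM n) := by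
    intro v v'
    refine integrable_bdd (((ind_comap_measurable _ hU v).sub_const _).mul
      ((ind_comap_measurable _ hU v').sub_const _)) 1 fun ω => ?_
    rw [abs_mul]
    exact mul_le_one₀ (abs_sub_le_one ⟨ind_nonneg _ _, ind_le_one _ _⟩ hμm) (abs_nonneg _)
      (abs_sub_le_one ⟨ind_nonneg _ _, ind_le_one _ _⟩ hμm)
  rw [integral_div, integral_finsetSum _ (fun v _ => integrable_finsetSum _ fun v' _ => hi v v'),
    div_le_iff₀ (by positivity)]
  simp_rw [integral_finsetSum _ (fun v' _ => hi _ v')]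
  have := second_moment (n := n) (j := j) (fun v v' => ∫ ω, (ind (R' j) ((gr U ω).comap v) - μ) *
      (ind (R' j) ((gr U ω).comap v') - μ) ∂(SM n)) (qv (R' j) U) μ 0 hn le_rfl
      (fun v => abs_sub_le_one (qv_mem _ _ _) hμm) ?_ ?_ ?_
  · simpa using this
  · rw [Finset.sum_sub_distrib, sum_qv hn hU]
    simp [hμ]
  · intro v v'
    have := norm_integral_le_of_norm_le_const (μ := SM n) (C := 1) (f := fun ω => (ind (R' j) ((gr U ω).comap v) - μ) *
      (ind (R' j) ((gr U ω).comap v') - μ)) (Eventually.of_forall fun ω => by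
        rw [Real.norm_eq_abs, abs_mul]
        exact mul_le_one₀ (abs_sub_le_one ⟨ind_nonneg _ _, ind_le_one _ _⟩ hμm) (abs_nonneg _)
          (abs_sub_le_one ⟨ind_nonneg _ _, ind_le_one _ _⟩ hμm))
    simp only [probReal_univ, mul_one] at this
    exact (le_abs_self _).trans this
  · intro v v' hvv
    obtain ⟨h1, h2, h3⟩ := sumElim_parts hvv
    simp_rw [gr_comap U _ h1, gr_comap U _ h2]
    have := integral_indep (smp (nu n)) (tau v) (tau v') (tau_disj hvv)
      (fun x => ind (R' j) (gr U x) - μ) (fun x => ind (R' j) (gr U x) - μ)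
      ((ind_gr_measurable hU _).sub_const _) ((ind_gr_measurable hU _).sub_const _)
    unfold SM
    rw [this]
    have e : ∀ w : Fin j → Fin n, ∫ x, (ind (R' j) (gr U x) - μ) ∂(Measure.pi fun a => smp (nu n) (tau w a))
        = qv (R' j) U w - μ := by
      intro w
      rw [smp_tau, integral_sub (integrable_bdd (ind_gr_measurable hU _) 1 fun _ => ind_abs _ _)
        (integrable_const _)]
      simp [qv]
    rw [e v, e v', add_zero]

lemma exists_perm_extend {κ : Type} {n : ℕ} {w w' : κ → Fin n} (hw : Function.Injective w)
    (hw' : Function.Injective w') : ∃ π : Equiv.Perm (Fin n), ∀ a, π (w a) = w' a := by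
  classical
  let e : {x // x ∈ Set.range w} ≃ {x // x ∈ Set.range w'} :=
    (Equiv.ofInjective w hw).symm.trans (Equiv.ofInjective w' hw')
  refine ⟨e.extendSubtype, fun a => ?_⟩
  rw [Equiv.extendSubtype_apply_of_mem e (w a) ⟨a, rfl⟩]
  have : (Equiv.ofInjective w hw).symm ⟨w a, ⟨a, rfl⟩⟩ = a := by
    rw [Equiv.symm_apply_eq]; rfl
  simp only [e, Equiv.trans_apply, this]
  rfl

lemma perm_avg {κ : Type} [Fintype κ] [DecidableEq κ] {n : ℕ} (hn : 0 < n) (φ : (κ → Fin n) → ℝ)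
    (hφ : ∀ w, |φ w| ≤ 1)
    (hsum : ∑ w, φ w = 0) (w0 : κ → Fin n) (hw0 : Function.Injective w0)
    (hsize : 2 * (Fintype.card κ) ^ 2 ≤ n) :
    ∑ σ : Equiv.Perm (Fin n), φ (fun a => σ (w0 a)) ≤
      (n.factorial : ℝ) * (2 * (Fintype.card κ) ^ 2 / n) := by
  classical
  set c := ∑ σ : Equiv.Perm (Fin n), φ (fun a => σ (w0 a)) with hc
  set m := Fintype.card κ with hm
  set I : Finset (κ → Fin n) := Finset.univ.filter fun w => Function.Injective w with hI
  set N : Finset (κ → Fin n) := Finset.univ.filter fun w => ¬ Function.Injective w with hN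
  have hn' : (0 : ℝ) < n := by exact_mod_cast hn
  have hNc : (n : ℝ) * N.card ≤ m ^ 2 * n ^ m := by
    have h1 := nonInj_le κ n
    have h2 : nonInj κ n = N.card := by unfold nonInj; congr; exact Subsingleton.elim _ _
    rw [h2] at h1
    exact_mod_cast h1
  have hIN : (I.card : ℝ) + N.card = n ^ m := by
    have := Finset.card_filter_add_card_filter_not (s := (Finset.univ : Finset (κ → Fin n))) (fun w => Function.Injective w)
    rw [Finset.card_univ, Fintype.card_fun, Fintype.card_fin] at this
    exact_mod_cast this
  have hconst : ∀ w ∈ I, ∑ σ : Equiv.Perm (Fin n), φ (fun a => σ (w a)) = c := by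
    intro w hw
    have hw := (Finset.mem_filter.1 hw).2
    obtain ⟨π, hπ⟩ := exists_perm_extend hw0 hw
    rw [hc]
    refine Fintype.sum_equiv (Equiv.mulRight π) _ _ fun σ => ?_
    congr 1
    ext a
    simp [hπ]
  have hinv : ∀ σ : Equiv.Perm (Fin n), ∑ w ∈ I, φ (fun a => σ (w a)) = ∑ w ∈ I, φ w := by
    intro σ
    rw [hI, Finset.sum_filter, Finset.sum_filter]
    refine Fintype.sum_equiv (Equiv.arrowCongr (Equiv.refl κ) σ) _ _ fun w => ?_
    have : Function.Injective ((Equiv.arrowCongr (Equiv.refl κ) σ) w) ↔ Function.Injective w := by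
      show Function.Injective (fun a => σ (w a)) ↔ _
      exact σ.injective.of_comp_iff w
    simp only [this]
    rfl
  have hIsum : ∑ w ∈ I, φ w ≤ N.card := by
    have h1 := Finset.sum_filter_add_sum_filter_not (Finset.univ : Finset (κ → Fin n)) (fun w => Function.Injective w) φ
    rw [hsum] at h1
    have h2 : -∑ w ∈ N, φ w ≤ N.card := by
      rw [← Finset.sum_neg_distrib]
      refine (Finset.sum_le_card_nsmul N _ 1 fun w _ => ?_).trans (by simp)
      have := (abs_le.1 (hφ w)).1
      linarith
    have : ∑ w ∈ I, φ w + ∑ w ∈ N, φ w = 0 := h1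
    linarith
  have hmain : (I.card : ℝ) * c ≤ n.factorial * N.card := by
    calc (I.card : ℝ) * c = ∑ w ∈ I, ∑ σ : Equiv.Perm (Fin n), φ (fun a => σ (w a)) := by
          rw [Finset.sum_congr rfl hconst]; simp
      _ = ∑ σ : Equiv.Perm (Fin n), ∑ w ∈ I, φ (fun a => σ (w a)) := Finset.sum_comm
      _ = n.factorial * ∑ w ∈ I, φ w := by
          simp_rw [hinv]; simp [Fintype.card_perm]
      _ ≤ _ := by gcongr
  have hN2 : (N.card : ℝ) ≤ m ^ 2 / n * n ^ m := by
    rw [div_mul_eq_mul_div, le_div_iff₀ hn']; linarith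
  have hs : (2 : ℝ) * m ^ 2 ≤ n := by exact_mod_cast hsize
  have hN3 : (N.card : ℝ) ≤ n ^ m / 2 := by
    have : (m : ℝ) ^ 2 / n ≤ 1 / 2 := by rw [div_le_div_iff₀ hn' (by norm_num)]; linarith
    calc (N.card : ℝ) ≤ m ^ 2 / n * n ^ m := hN2
      _ ≤ 1 / 2 * n ^ m := by gcongr
      _ = _ := by ring
  rcases le_or_gt c 0 with hc0 | hc0
  · exact hc0.trans (by positivity)
  · have hp : (0 : ℝ) < n ^ m := by positivity
    have h1 : (n : ℝ) ^ m / 2 * c ≤ n.factorial * (m ^ 2 / n * n ^ m) := by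
      calc (n : ℝ) ^ m / 2 * c ≤ I.card * c := by gcongr; linarith
        _ ≤ n.factorial * N.card := hmain
        _ ≤ _ := by gcongr
    have h2 : (n : ℝ) ^ m * c ≤ (n : ℝ) ^ m * (n.factorial * (2 * m ^ 2 / n)) := by
      calc (n : ℝ) ^ m * c = 2 * ((n : ℝ) ^ m / 2 * c) := by ring
        _ ≤ 2 * (n.factorial * (m ^ 2 / n * n ^ m)) := by gcongr
        _ = _ := by ring
    exact le_of_mul_le_mul_left h2 hp

/-- The graph induced on the image of the first `k` vertices under a permutation. -/
def sub {n k : ℕ} (h : k ≤ n) (G : SimpleGraph (Fin n)) (σ : Equiv.Perm (Fin n)) :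
    SimpleGraph (Fin k) := G.comap fun a => σ (Fin.castLE h a)

lemma sub_variance {n k j : ℕ} (hk : 0 < k) (h : k ≤ n) (hj : 8 * j ^ 2 ≤ k)
    (A : Set (SimpleGraph (Fin j))) (G : SimpleGraph (Fin n)) :
    ∑ σ : Equiv.Perm (Fin n), (frac A (sub h G σ) - frac A G) ^ 2 ≤
      (n.factorial : ℝ) * (16 * j ^ 2 / k) := by
  classical
  have hn : 0 < n := by omega
  have hn' : (0 : ℝ) < n := by exact_mod_cast hn
  have hk' : (0 : ℝ) < k := by exact_mod_cast hk
  have hkn : (k : ℝ) ≤ n := by exact_mod_cast h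
  set μ := frac A G with hμ
  have hμm := frac_mem A G
  have hf : (0 : ℝ) < n.factorial := by exact_mod_cast n.factorial_pos
  have hcm : ∀ σ (v : Fin j → Fin k), (sub h G σ).comap v = G.comap fun a => σ (Fin.castLE h (v a)) := by
    intro σ v; rfl
  simp_rw [frac_sub_sq hk, hcm]
  rw [← Finset.sum_div, div_le_iff₀ (by positivity), Finset.sum_comm]
  simp_rw [Finset.sum_comm (s := (Finset.univ : Finset (Equiv.Perm (Fin n))))]
  have hb : ∀ (u u' : Fin j → Fin n), |(ind A (G.comap u) - μ) * (ind A (G.comap u') - μ)| ≤ 1 := by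
    intro u u'
    rw [abs_mul]
    exact mul_le_one₀ (abs_sub_le_one ⟨ind_nonneg _ _, ind_le_one _ _⟩ hμm) (abs_nonneg _)
      (abs_sub_le_one ⟨ind_nonneg _ _, ind_le_one _ _⟩ hμm)
  have h0 : ∑ u : Fin j → Fin n, (ind A (G.comap u) - μ) = 0 := by
    have := sum_frac_sub hn A G μ
    rw [hμ, sub_self] at this
    have hp : (n : ℝ) ^ j ≠ 0 := by positivity
    field_simp at this
    rw [hμ]; linarith
  have key := second_moment (n := k) (j := j) (fun v v' => (n.factorial : ℝ)⁻¹ * ∑ σ : Equiv.Perm (Fin n),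
      (ind A (G.comap fun a => σ (Fin.castLE h (v a))) - μ) *
      (ind A (G.comap fun a => σ (Fin.castLE h (v' a))) - μ)) (fun _ => μ) μ (8 * j ^ 2 / n) hk (by positivity)
      (by simp) (by simp) ?_ ?_
  · simp_rw [← Finset.mul_sum] at key
    rw [inv_mul_le_iff₀ hf] at key
    refine key.trans ?_
    rw [mul_assoc]
    have : (8 * (j : ℝ) ^ 2 / k + 8 * j ^ 2 / n) ≤ 16 * j ^ 2 / k := by
      have : 8 * (j : ℝ) ^ 2 / n ≤ 8 * j ^ 2 / k := by gcongr
      have e : 16 * (j : ℝ) ^ 2 / k = 8 * j ^ 2 / k + 8 * j ^ 2 / k := by ring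
      linarith
    gcongr
  · intro v v'
    rw [inv_mul_le_iff₀ hf]
    refine (Finset.sum_le_card_nsmul _ _ 1 fun σ _ => (le_abs_self _).trans (hb _ _)).trans ?_
    simp [Fintype.card_perm]
  · intro v v' hvv
    rw [inv_mul_le_iff₀ hf, sub_self, zero_mul, zero_add]
    have hw : Function.Injective (fun a => Fin.castLE h (Sum.elim v v' a)) :=
      (Fin.castLE_injective h).comp hvv
    have := perm_avg hn (fun w : Fin j ⊕ Fin j → Fin n => (ind A (G.comap fun a => w (Sum.inl a)) - μ) *
      (ind A (G.comap fun a => w (Sum.inr a)) - μ)) (fun w => hb _ _) ?_ _ hw ?_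
    · simp only [Sum.elim_inl, Sum.elim_inr, Fintype.card_sum, Fintype.card_fin] at this
      refine this.trans (le_of_eq ?_)
      push_cast
      ring
    · have := Fintype.sum_equiv (Equiv.sumArrowEquivProdArrow (Fin j) (Fin j) (Fin n))
        (fun w : Fin j ⊕ Fin j → Fin n => (ind A (G.comap fun a => w (Sum.inl a)) - μ) *
          (ind A (G.comap fun a => w (Sum.inr a)) - μ))
        (fun p => (ind A (G.comap p.1) - μ) * (ind A (G.comap p.2) - μ)) (fun w => rfl)
      rw [this, ← Finset.univ_product_univ, Finset.sum_product]
      simp only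
      rw [← Finset.sum_mul_sum, h0, zero_mul]
    · simp only [Fintype.card_sum, Fintype.card_fin]
      calc 2 * (j + j) ^ 2 = 8 * j ^ 2 := by ring
        _ ≤ k := hj
        _ ≤ n := h

open Classical in
/-- Number of permutations whose induced graph has the property. -/
def goodPerm {n k : ℕ} (h : k ≤ n) (G : SimpleGraph (Fin n)) (P : GraphProp) : ℕ :=
  (Finset.univ.filter fun σ : Equiv.Perm (Fin n) => sub h G σ ∈ P k).card

lemma goodCount_perm {n k : ℕ} (h : k ≤ n) (G : SimpleGraph (Fin n)) (P : GraphProp)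
    (hP : IsGraphProperty P) :
    ∃ c : ℕ, 0 < c ∧ n.factorial = c * n.choose k ∧ goodPerm h G P = c * goodCount G k P := by
  classical
  let im : Equiv.Perm (Fin n) → Finset (Fin n) := fun σ =>
    Finset.univ.image fun a : Fin k => σ (Fin.castLE h a)
  have him : ∀ σ, (im σ).card = k := by
    intro σ
    exact (Finset.card_image_of_injective _ (σ.injective.comp (Fin.castLE_injective h))).trans (by simp)
  let cS : Finset (Fin n) → ℕ := fun S => (Finset.univ.filter fun σ => im σ = S).card
  let S0 := im 1
  have hconst : ∀ S ∈ Finset.powersetCard k (Finset.univ : Finset (Fin n)), cS S = cS S0 := by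
    intro S hS
    have hS := (Finset.mem_powersetCard.1 hS).2
    have hex : ∃ π : Equiv.Perm (Fin n), S0.image π = S := by
      have e1 : Function.Injective (S0.orderEmbOfFin (him 1)) := (S0.orderEmbOfFin (him 1)).injective
      have e2 : Function.Injective (S.orderEmbOfFin hS) := (S.orderEmbOfFin hS).injective
      obtain ⟨π, hπ⟩ := exists_perm_extend e1 e2
      refine ⟨π, ?_⟩
      apply Finset.coe_injective
      rw [Finset.coe_image, ← Finset.range_orderEmbOfFin S0 (him 1), ← Set.range_comp,
        ← Finset.range_orderEmbOfFin S hS]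
      congr 1
      ext a
      exact congrArg _ (hπ a)
    obtain ⟨π, hπ⟩ := hex
    symm
    refine Finset.card_bijective (fun σ => π * σ) (Equiv.mulLeft π).bijective fun σ => ?_
    simp only [Finset.mem_filter, Finset.mem_univ, true_and]
    have : im (π * σ) = (im σ).image π := by
      simp only [im, Finset.image_image]; rfl
    rw [this, ← hπ]
    constructor
    · intro hh; rw [hh]
    · intro hh; exact Finset.image_injective π.injective hh
  have hpos : 0 < cS S0 := Finset.card_pos.2 ⟨1, by simp [S0]⟩
  have hcount : ∀ Q : Finset (Fin n) → Prop,
      (Finset.univ.filter fun σ => Q (im σ)).card =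
        cS S0 * ((Finset.powersetCard k (Finset.univ : Finset (Fin n))).filter Q).card := by
    intro Q
    rw [Finset.card_eq_sum_card_fiberwise (f := im)
      (t := (Finset.powersetCard k (Finset.univ : Finset (Fin n))).filter Q)]
    · rw [Finset.sum_congr rfl (g := fun _ => cS S0), Finset.sum_const, smul_eq_mul, mul_comm]
      intro S hS
      rw [← hconst S (Finset.mem_filter.1 hS).1]
      congr 1
      ext σ
      simp only [Finset.mem_filter, Finset.mem_univ, true_and]
      constructor
      · rintro ⟨_, h⟩; exact h
      · intro h; rw [h]; exact ⟨(Finset.mem_filter.1 hS).2, rfl⟩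
    · intro σ hσ
      have hσ := (Finset.mem_filter.1 (Finset.mem_coe.1 hσ)).2
      exact Finset.mem_coe.2 (Finset.mem_filter.2 ⟨Finset.mem_powersetCard.2 ⟨Finset.subset_univ _, him σ⟩, hσ⟩)
  refine ⟨cS S0, hpos, ?_, ?_⟩
  · have := hcount fun _ => True
    simpa [Finset.card_univ, Fintype.card_perm, Finset.card_powersetCard] using this
  · have h1 := hcount fun S => inducedMem G S k P
    have h2 : goodCount G k P = ((Finset.powersetCard k (Finset.univ : Finset (Fin n))).filter
        fun S => inducedMem G S k P).card := by
      unfold goodCount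
      rw [← Set.ncard_coe_finset]
      congr 1
      ext S
      simp [Finset.mem_powersetCard]
    rw [h2, ← h1]
    unfold goodPerm
    congr 1
    ext σ
    simp only [Finset.mem_filter, Finset.mem_univ, true_and]
    have hinj : Function.Injective fun a : Fin k => σ (Fin.castLE h a) :=
      σ.injective.comp (Fin.castLE_injective h)
    constructor
    · intro hσ
      exact ⟨sub h G σ, hσ, ⟨_, hinj⟩, fun i => Finset.mem_image_of_mem _ (Finset.mem_univ i),
        fun i j => Iff.rfl⟩
    · rintro ⟨H, hH, f, hf, hadj⟩
      choose g hg using fun i => Finset.mem_image.1 (hf i)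
      have hg' : ∀ i, σ (Fin.castLE h (g i)) = f i := fun i => (hg i).2
      have hginj : Function.Injective g := by
        intro a b hab
        apply f.injective
        rw [← hg' a, ← hg' b, hab]
      let e : Fin k ≃ Fin k := Equiv.ofBijective g (Finite.injective_iff_bijective.1 hginj)
      refine (hP k H (sub h G σ) ⟨⟨e, ?_⟩⟩).1 hH
      intro a b
      show G.Adj (σ (Fin.castLE h (g a))) (σ (Fin.castLE h (g b))) ↔ _
      rw [hg', hg', hadj]

lemma abs_int_le_const {α : Type*} [MeasurableSpace α] {μ : Measure α} [IsProbabilityMeasure μ]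
    {f : α → ℝ} {C : ℝ} (h : ∀ x, |f x| ≤ C) : |∫ x, f x ∂μ| ≤ C := by
  have := norm_integral_le_of_norm_le_const (μ := μ) (f := f) (C := C) (Eventually.of_forall h)
  simpa using this

/-- Bilinear pairing of a kernel with two functions. -/
def cutInt (f g : ℝ → ℝ) (D : ℝ → ℝ → ℝ) : ℝ := ∫ x, ∫ y, f x * g y * D x y ∂lam ∂lam

/-- Bounded measurable kernels. -/
def BM (D : ℝ → ℝ → ℝ) : Prop := Measurable (Function.uncurry D) ∧ ∃ C, ∀ x y, |D x y| ≤ C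

/-- Measurable functions with values in the unit interval. -/
def UF (f : ℝ → ℝ) : Prop := Measurable f ∧ ∀ x, 0 ≤ f x ∧ f x ≤ 1

/-- Indicator functions. -/
def chi (S : Set ℝ) : ℝ → ℝ := S.indicator fun _ => 1

lemma chi_UF {S : Set ℝ} (hS : MeasurableSet S) : UF (chi S) := by
  refine ⟨measurable_const.indicator hS, fun x => ?_⟩
  unfold chi Set.indicator
  split_ifs <;> norm_num

lemma BM.neg {D : ℝ → ℝ → ℝ} (hD : BM D) : BM (fun x y => - D x y) := by
  obtain ⟨h1, C, hC⟩ := hD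
  exact ⟨h1.neg, C, fun x y => by rw [abs_neg]; exact hC x y⟩

lemma BM.swap {D : ℝ → ℝ → ℝ} (hD : BM D) : BM (fun x y => D y x) := by
  obtain ⟨h1, C, hC⟩ := hD
  exact ⟨h1.comp measurable_swap, C, fun x y => hC y x⟩

lemma BM.sub {D D' : ℝ → ℝ → ℝ} (hD : BM D) (hD' : BM D') : BM (fun x y => D x y - D' x y) := by
  obtain ⟨h1, C, hC⟩ := hD
  obtain ⟨h1', C', hC'⟩ := hD'
  exact ⟨h1.sub h1', C + C', fun x y => (abs_sub _ _).trans (add_le_add (hC x y) (hC' x y))⟩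

lemma BM.add {D D' : ℝ → ℝ → ℝ} (hD : BM D) (hD' : BM D') : BM (fun x y => D x y + D' x y) := by
  obtain ⟨h1, C, hC⟩ := hD
  obtain ⟨h1', C', hC'⟩ := hD'
  exact ⟨h1.add h1', C + C', fun x y => (abs_add_le _ _).trans (add_le_add (hC x y) (hC' x y))⟩

lemma IsGraphon.bm {W : ℝ → ℝ → ℝ} (hW : IsGraphon W) : BM W :=
  ⟨hW.1, 1, fun x y => by rw [abs_of_nonneg (hW.2.2 x y).1]; exact (hW.2.2 x y).2⟩

lemma UF.abs {f : ℝ → ℝ} (hf : UF f) (x : ℝ) : |f x| ≤ 1 := by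
  rw [abs_of_nonneg (hf.2 x).1]; exact (hf.2 x).2

lemma BM.mul {D : ℝ → ℝ → ℝ} (hD : BM D) {f g : ℝ → ℝ} (hf : UF f) (hg : UF g) :
    BM (fun x y => f x * g y * D x y) := by
  obtain ⟨h1, C, hC⟩ := hD
  have hC0 : 0 ≤ C := (abs_nonneg _).trans (hC 0 0)
  refine ⟨((hf.1.comp measurable_fst).mul (hg.1.comp measurable_snd)).mul h1, C, fun x y => ?_⟩
  rw [abs_mul, abs_mul]
  calc |f x| * |g y| * |D x y| ≤ 1 * 1 * C := by
        gcongr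
        · exact hf.abs x
        · exact hg.abs y
        · exact hC x y
    _ = C := by ring

lemma BM.row {D : ℝ → ℝ → ℝ} (hD : BM D) (x : ℝ) {μ : Measure ℝ} [IsFiniteMeasure μ] :
    Integrable (D x) μ := by
  obtain ⟨h1, C, hC⟩ := hD
  exact integrable_bdd (h1.comp measurable_prodMk_left) C (hC x)

lemma BM.int_meas {D : ℝ → ℝ → ℝ} (hD : BM D) {ν : Measure ℝ} [IsProbabilityMeasure ν] :
    Measurable (fun x => ∫ y, D x y ∂ν) :=
  (hD.1.stronglyMeasurable.integral_prod_right (ν := ν)).measurable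

lemma BM.int_bdd {D : ℝ → ℝ → ℝ} (hD : BM D) {ν : Measure ℝ} [IsProbabilityMeasure ν] :
    ∃ C, ∀ x, |∫ y, D x y ∂ν| ≤ C := by
  obtain ⟨h1, C, hC⟩ := hD
  refine ⟨C, fun x => ?_⟩
  have := norm_integral_le_of_norm_le_const (μ := ν) (f := D x) (C := C) (Eventually.of_forall (hC x))
  simpa using this

lemma BM.int_int {D : ℝ → ℝ → ℝ} (hD : BM D) {μ ν : Measure ℝ} [IsProbabilityMeasure μ]
    [IsProbabilityMeasure ν] : Integrable (fun x => ∫ y, D x y ∂ν) μ := by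
  obtain ⟨C, hC⟩ := hD.int_bdd (ν := ν)
  exact integrable_bdd hD.int_meas C hC

lemma BM.abs {D : ℝ → ℝ → ℝ} (hD : BM D) : BM (fun x y => |D x y|) := by
  obtain ⟨h1, C, hC⟩ := hD
  exact ⟨measurable_norm.comp h1, C, fun x y => by rw [abs_abs]; exact hC x y⟩

lemma BM.int_abs {D : ℝ → ℝ → ℝ} (hD : BM D) {μ ν : Measure ℝ} [IsProbabilityMeasure μ]
    [IsProbabilityMeasure ν] : |∫ x, ∫ y, D x y ∂ν ∂μ| ≤ ∫ x, ∫ y, |D x y| ∂ν ∂μ := by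
  refine (abs_integral_le_integral_abs).trans ?_
  exact integral_mono hD.int_int.abs hD.abs.int_int fun x => abs_integral_le_integral_abs

lemma BM.mono {D D' : ℝ → ℝ → ℝ} (hD : BM D) (hD' : BM D') (h : ∀ x y, D x y ≤ D' x y)
    {μ ν : Measure ℝ} [IsProbabilityMeasure μ]
    [IsProbabilityMeasure ν] : ∫ x, ∫ y, D x y ∂ν ∂μ ≤ ∫ x, ∫ y, D' x y ∂ν ∂μ :=
  integral_mono hD.int_int hD'.int_int fun x => integral_mono (hD.row x) (hD'.row x) (h x)

lemma BM.int_swap {D : ℝ → ℝ → ℝ} (hD : BM D) {μ ν : Measure ℝ} [IsProbabilityMeasure μ]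
    [IsProbabilityMeasure ν] : ∫ x, ∫ y, D x y ∂ν ∂μ = ∫ y, ∫ x, D x y ∂μ ∂ν := by
  obtain ⟨h1, C, hC⟩ := hD
  exact integral_integral_swap (integrable_bdd h1 C fun p => hC p.1 p.2)

lemma l1Norm_eq (D : ℝ → ℝ → ℝ) : l1Norm D = ∫ x, ∫ y, |D x y| ∂lam ∂lam := rfl

lemma cut_set_eq (D : ℝ → ℝ → ℝ) {S T : Set ℝ} (hS : MeasurableSet S) (hT : MeasurableSet T) :
    cutInt (chi S) (chi T) D = ∫ x in S ∩ I01, ∫ y in T ∩ I01, D x y := by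
  have h1 : ∀ (A : Set ℝ) (hA : MeasurableSet A) (h : ℝ → ℝ), ∫ x, chi A x * h x ∂lam
      = ∫ x in A ∩ I01, h x := by
    intro A hA h
    have : (fun x => chi A x * h x) = A.indicator h := by
      ext x; unfold chi; by_cases hx : x ∈ A <;> simp [hx]
    rw [this, integral_indicator hA, lam, Measure.restrict_restrict hA]
  unfold cutInt
  simp_rw [mul_assoc, integral_const_mul]
  rw [h1 S hS]
  simp_rw [h1 T hT]

lemma cutInt_abs_le {D : ℝ → ℝ → ℝ} (hD : BM D) {f g : ℝ → ℝ} (hf : UF f) (hg : UF g) :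
    |cutInt f g D| ≤ l1Norm D := by
  refine (hD.mul hf hg).int_abs.trans ?_
  rw [l1Norm_eq]
  refine (hD.mul hf hg).abs.mono hD.abs fun x y => ?_
  rw [abs_mul, abs_mul]
  calc |f x| * |g y| * |D x y| ≤ 1 * 1 * |D x y| := by
        gcongr
        · exact hf.abs x
        · exact hg.abs y
    _ = _ := by ring

lemma cutNorm_le {D : ℝ → ℝ → ℝ} {B : ℝ}
    (h : ∀ S T, MeasurableSet S → MeasurableSet T → |cutInt (chi S) (chi T) D| ≤ B) :
    cutNorm D ≤ B := by
  refine csSup_le ⟨_, ∅, ∅, MeasurableSet.empty, MeasurableSet.empty, by simp, by simp, rfl⟩ ?_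
  rintro r ⟨S, T, hS, hT, hSI, hTI, rfl⟩
  have := h S T hS hT
  rwa [cut_set_eq D hS hT, Set.inter_eq_left.2 hSI, Set.inter_eq_left.2 hTI] at this

lemma cutNorm_bddAbove {D : ℝ → ℝ → ℝ} (hD : BM D) :
    BddAbove { r : ℝ | ∃ S T : Set ℝ, MeasurableSet S ∧ MeasurableSet T ∧ S ⊆ I01 ∧ T ⊆ I01 ∧
    r = |∫ x in S, ∫ y in T, D x y| } := by
  refine ⟨l1Norm D, ?_⟩
  rintro r ⟨S, T, hS, hT, hSI, hTI, rfl⟩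
  have := cutInt_abs_le hD (chi_UF hS) (chi_UF hT)
  rwa [cut_set_eq D hS hT, Set.inter_eq_left.2 hSI, Set.inter_eq_left.2 hTI] at this

lemma le_cutNorm_set {D : ℝ → ℝ → ℝ} (hD : BM D) {S T : Set ℝ} (hS : MeasurableSet S)
    (hT : MeasurableSet T) : |cutInt (chi S) (chi T) D| ≤ cutNorm D := by
  have hI : MeasurableSet I01 := measurableSet_Icc
  refine le_csSup (cutNorm_bddAbove hD) ⟨S ∩ I01, T ∩ I01, hS.inter hI, hT.inter hI,
    Set.inter_subset_right, Set.inter_subset_right, ?_⟩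
  rw [cut_set_eq D hS hT]

lemma cutNorm_le_l1 {D : ℝ → ℝ → ℝ} (hD : BM D) : cutNorm D ≤ l1Norm D :=
  cutNorm_le fun _ _ hS hT => cutInt_abs_le hD (chi_UF hS) (chi_UF hT)

lemma cutNorm_nonneg (D : ℝ → ℝ → ℝ) : 0 ≤ cutNorm D := by
  apply Real.sSup_nonneg
  rintro r ⟨S, T, -, -, -, -, rfl⟩
  exact abs_nonneg _

lemma cutInt_swap {D : ℝ → ℝ → ℝ} (hD : BM D) {f g : ℝ → ℝ} (hf : UF f) (hg : UF g) :
    cutInt f g D = cutInt g f (fun x y => D y x) := by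
  unfold cutInt
  rw [(hD.mul hf hg).int_swap]
  simp_rw [mul_comm (f _)]

lemma cutInt_le_left {D : ℝ → ℝ → ℝ} (hD : BM D) {f g : ℝ → ℝ} (hf : UF f) (hg : UF g) :
    ∃ S, MeasurableSet S ∧ cutInt f g D ≤ cutInt (chi S) g D := by
  have hone : UF (fun _ => (1 : ℝ)) := ⟨measurable_const, fun x => by norm_num⟩
  have hD1 := hD.mul hone hg
  set h : ℝ → ℝ := fun x => ∫ y, 1 * g y * D x y ∂lam with hh
  have hhm : Measurable h := hD1.int_meas
  obtain ⟨C, hC⟩ := hD1.int_bdd (ν := lam)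
  have e : ∀ f : ℝ → ℝ, cutInt f g D = ∫ x, f x * h x ∂lam := by
    intro f
    unfold cutInt
    simp_rw [hh, mul_assoc, integral_const_mul, one_mul]
  have hIntg : ∀ f : ℝ → ℝ, UF f → Integrable (fun x => f x * h x) lam := by
    intro f hf
    refine integrable_bdd (hf.1.mul hhm) C fun x => ?_
    rw [abs_mul]
    calc |f x| * |h x| ≤ 1 * |h x| := by gcongr; exact hf.abs x
      _ ≤ C := by rw [one_mul]; exact hC x
  have hS : MeasurableSet {x | 0 < h x} := measurableSet_lt measurable_const hhm
  refine ⟨_, hS, ?_⟩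
  rw [e, e]
  refine integral_mono (hIntg f hf) (hIntg _ (chi_UF hS)) fun x => ?_
  have := hf.2 x
  by_cases hx : 0 < h x
  · have : chi {x | 0 < h x} x = 1 := by unfold chi; exact Set.indicator_of_mem (show x ∈ {x | 0 < h x} from hx) _
    simp only [this]
    nlinarith
  · have : chi {x | 0 < h x} x = 0 := by unfold chi; exact Set.indicator_of_notMem (show x ∉ {x | 0 < h x} from hx) _
    simp only [this]
    nlinarith

lemma cutInt_le {D : ℝ → ℝ → ℝ} (hD : BM D) {f g : ℝ → ℝ} (hf : UF f) (hg : UF g) :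
    ∃ S T, MeasurableSet S ∧ MeasurableSet T ∧ cutInt f g D ≤ cutInt (chi S) (chi T) D := by
  obtain ⟨S, hS, h1⟩ := cutInt_le_left hD hf hg
  obtain ⟨T, hT, h2⟩ := cutInt_le_left hD.swap hg (chi_UF hS)
  rw [← cutInt_swap hD (chi_UF hS) hg, ← cutInt_swap hD (chi_UF hS) (chi_UF hT)] at h2
  exact ⟨S, T, hS, hT, h1.trans h2⟩

lemma cutInt_neg (D : ℝ → ℝ → ℝ) (f g : ℝ → ℝ) : cutInt f g (fun x y => - D x y) = - cutInt f g D := by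
  unfold cutInt
  simp_rw [mul_neg, integral_neg]

lemma le_cutNorm {D : ℝ → ℝ → ℝ} (hD : BM D) {f g : ℝ → ℝ} (hf : UF f) (hg : UF g) :
    |cutInt f g D| ≤ cutNorm D := by
  rw [abs_le]
  constructor
  · obtain ⟨S, T, hS, hT, h⟩ := cutInt_le hD.neg hf hg
    rw [cutInt_neg, cutInt_neg] at h
    have := (abs_le.1 (le_cutNorm_set hD hS hT)).1
    linarith
  · obtain ⟨S, T, hS, hT, h⟩ := cutInt_le hD hf hg
    exact h.trans ((le_abs_self _).trans (le_cutNorm_set hD hS hT))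

lemma cutNorm_add {D D' : ℝ → ℝ → ℝ} (hD : BM D) (hD' : BM D') :
    cutNorm (fun x y => D x y + D' x y) ≤ cutNorm D + cutNorm D' := by
  refine cutNorm_le fun S T hS hT => ?_
  have : cutInt (chi S) (chi T) (fun x y => D x y + D' x y)
      = cutInt (chi S) (chi T) D + cutInt (chi S) (chi T) D' := by
    have h1 := hD.mul (chi_UF hS) (chi_UF hT)
    have h2 := hD'.mul (chi_UF hS) (chi_UF hT)
    unfold cutInt
    rw [← integral_add h1.int_int h2.int_int]
    congr 1
    ext x
    rw [← integral_add (h1.row x) (h2.row x)]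
    congr 1
    ext y
    ring
  rw [this]
  exact (abs_add_le _ _).trans (add_le_add (le_cutNorm_set hD hS hT) (le_cutNorm_set hD' hS hT))

/-- Product of kernels over pairs. -/
def pairProd {k : ℕ} (H : Fin k × Fin k → ℝ → ℝ → ℝ) (x : Fin k → ℝ) : ℝ :=
  ∏ q, H q (x q.1) (x q.2)

lemma pairProd_step {k : ℕ} (H H' : Fin k × Fin k → ℝ → ℝ → ℝ) (D : ℝ → ℝ → ℝ)
    (hD : BM D) (hsym : ∀ x y, D x y = D y x) (p : Fin k × Fin k) (hp : p.1 < p.2)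
    (hm : ∀ q, Measurable (Function.uncurry (H q))) (hm' : ∀ q, Measurable (Function.uncurry (H' q)))
    (hb : ∀ q x y, 0 ≤ H q x y ∧ H q x y ≤ 1) (hb' : ∀ q x y, 0 ≤ H' q x y ∧ H' q x y ≤ 1)
    (htriv : ∀ q : Fin k × Fin k, ¬ q.1 < q.2 → ∀ x y, H q x y = 1)
    (heq : ∀ q, q ≠ p → H q = H' q) (hdiff : ∀ x y, H p x y - H' p x y = D x y) :
    |∫ x, pairProd H x ∂(Measure.pi fun _ : Fin k => lam) -
      ∫ x, pairProd H' x ∂(Measure.pi fun _ : Fin k => lam)| ≤ cutNorm D := by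
  obtain ⟨i, j⟩ := p
  simp only at hp
  have hij : i ≠ j := hp.ne
  have hmeas : ∀ (K : Fin k × Fin k → ℝ → ℝ → ℝ), (∀ q, Measurable (Function.uncurry (K q))) →
      ∀ s : Finset (Fin k × Fin k), Measurable fun x : Fin k → ℝ => ∏ q ∈ s, K q (x q.1) (x q.2) := by
    intro K hK s
    refine Finset.measurable_prod _ fun q _ => ?_
    have h2 : Measurable (fun x : Fin k → ℝ => (x q.1, x q.2)) :=
      (measurable_pi_apply q.1).prodMk (measurable_pi_apply q.2)
    exact (hK q).comp h2
  have hbd : ∀ (K : Fin k × Fin k → ℝ → ℝ → ℝ), (∀ q x y, 0 ≤ K q x y ∧ K q x y ≤ 1) →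
      ∀ (s : Finset (Fin k × Fin k)) (u v : Fin k × Fin k → ℝ), 0 ≤ ∏ q ∈ s, K q (u q) (v q) ∧
        ∏ q ∈ s, K q (u q) (v q) ≤ 1 := by
    intro K hK s u v
    exact ⟨Finset.prod_nonneg fun q _ => (hK _ _ _).1, Finset.prod_le_one (fun q _ => (hK _ _ _).1)
      fun q _ => (hK _ _ _).2⟩
  have hIntg : ∀ (K : Fin k × Fin k → ℝ → ℝ → ℝ), (∀ q, Measurable (Function.uncurry (K q))) →
      (∀ q x y, 0 ≤ K q x y ∧ K q x y ≤ 1) →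
      Integrable (pairProd K) (Measure.pi fun _ : Fin k => lam) := by
    intro K hK hK'
    refine integrable_bdd (hmeas K hK _) 1 fun x => ?_
    have := hbd K hK' Finset.univ (fun q => x q.1) (fun q => x q.2)
    unfold pairProd
    rw [abs_of_nonneg this.1]; exact this.2
  rw [← integral_sub (hIntg H hm hb) (hIntg H' hm' hb')]
  set E := (Finset.univ : Finset (Fin k × Fin k)).erase (i, j) with hE
  set f : (Fin k → ℝ) → ℝ := fun x => D (x i) (x j) * ∏ q ∈ E, H q (x q.1) (x q.2) with hf
  have e1 : (fun x => pairProd H x - pairProd H' x) = f := by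
    ext x
    unfold pairProd
    rw [← Finset.mul_prod_erase Finset.univ (fun q => H q (x q.1) (x q.2)) (Finset.mem_univ (i, j)),
      ← Finset.mul_prod_erase Finset.univ (fun q => H' q (x q.1) (x q.2)) (Finset.mem_univ (i, j)),
      ← Finset.prod_congr (f := fun q => H q (x q.1) (x q.2)) (g := fun q => H' q (x q.1) (x q.2)) (rfl : E = E)
        (fun q hq => by rw [heq q (Finset.ne_of_mem_erase hq)]), ← sub_mul, hdiff]
  rw [e1]
  obtain ⟨C, hC⟩ := hD.2
  have hC0 : 0 ≤ C := (abs_nonneg _).trans (hC 0 0)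
  have hij2 : Measurable (fun x : Fin k → ℝ => (x i, x j)) :=
      (measurable_pi_apply i).prodMk (measurable_pi_apply j)
  have hfm : Measurable f := (hD.1.comp hij2).mul (hmeas H hm E)
  have hfb : ∀ x, |f x| ≤ C := by
    intro x
    have := hbd H hb E (fun q => x q.1) (fun q => x q.2)
    rw [hf, abs_mul, abs_of_nonneg this.1]
    calc _ ≤ C * 1 := mul_le_mul (hC _ _) this.2 this.1 hC0
      _ = C := mul_one C
  rw [integral_resample _ i f hfm C hfb]
  have hm2 : Measurable (fun x : Fin k → ℝ => ∫ t, f (Function.update x i t) ∂lam) := by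
    have : Measurable (fun p : (Fin k → ℝ) × ℝ => f (Function.update p.1 i p.2)) :=
      hfm.comp (pi_resample (fun _ : Fin k => lam) i).measurable
    exact (this.stronglyMeasurable.integral_prod_right' (ν := lam)).measurable
  rw [integral_resample _ j _ hm2 C]
  · refine abs_int_le_const fun ω => ?_
    set A : ℝ → ℝ := fun s => ∏ q ∈ E.filter (fun q => q.1 = i ∨ q.2 = i),
      H q (Function.update ω i s q.1) (Function.update ω i s q.2) with hA
    set B : ℝ → ℝ := fun t => ∏ q ∈ E.filter (fun q => ¬ (q.1 = i ∨ q.2 = i)),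
      H q (Function.update ω j t q.1) (Function.update ω j t q.2) with hB
    have hAB : ∀ t s, f (Function.update (Function.update ω j t) i s) = B t * A s * D t s := by
      intro t s
      simp only [hf]
      rw [Function.update_self, Function.update_of_ne hij.symm, Function.update_self,
        ← Finset.prod_filter_mul_prod_filter_not E (fun q => q.1 = i ∨ q.2 = i), hsym]
      have hA' : ∏ q ∈ E.filter (fun q => q.1 = i ∨ q.2 = i),
          H q (Function.update (Function.update ω j t) i s q.1) (Function.update (Function.update ω j t) i s q.2)
          = A s := by
        refine Finset.prod_congr rfl fun q hq => ?_
        obtain ⟨hqE, hqi⟩ := Finset.mem_filter.1 hq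
        by_cases hlt : q.1 < q.2
        · have hqne := Finset.ne_of_mem_erase hqE
          have h1 : q.1 ≠ j := by
            intro h
            rcases hqi with h' | h'
            · exact hij (h'.symm.trans h)
            · rw [h, h'] at hlt; exact absurd (hlt.trans hp) (lt_irrefl _)
          have h2 : q.2 ≠ j := by
            intro h
            rcases hqi with h' | h'
            · exact hqne (Prod.ext h' h)
            · exact hij (h'.symm.trans h)
          have : ∀ a, a ≠ j → Function.update (Function.update ω j t) i s a = Function.update ω i s a := by
            intro a ha
            by_cases hai : a = i
            · subst hai; simp
            · rw [Function.update_of_ne hai, Function.update_of_ne hai, Function.update_of_ne ha]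
          rw [this _ h1, this _ h2]
        · rw [htriv q hlt, htriv q hlt]
      have hB' : ∏ q ∈ E.filter (fun q => ¬ (q.1 = i ∨ q.2 = i)),
          H q (Function.update (Function.update ω j t) i s q.1) (Function.update (Function.update ω j t) i s q.2)
          = B t := by
        refine Finset.prod_congr rfl fun q hq => ?_
        obtain ⟨hqE, hqi⟩ := Finset.mem_filter.1 hq
        push Not at hqi
        rw [Function.update_of_ne hqi.1, Function.update_of_ne hqi.2]
      rw [hA', hB']
      ring
    simp_rw [hAB]
    refine le_cutNorm hD (f := B) (g := A) ⟨?_, fun t => hbd H hb _ _ _⟩ ⟨?_, fun t => hbd H hb _ _ _⟩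
    · exact (hmeas H hm _).comp (measurable_update ω)
    · exact (hmeas H hm _).comp (measurable_update ω)
  · intro x
    have := norm_integral_le_of_norm_le_const (μ := lam) (f := fun t => f (Function.update x i t))
      (C := C) (Eventually.of_forall fun t => hfb _)
    simpa using this

open Classical in
/-- The factor for a pair in the induced density. -/
def fac {k : ℕ} (F : SimpleGraph (Fin k)) (W : ℝ → ℝ → ℝ) (q : Fin k × Fin k) (x y : ℝ) : ℝ :=
  if q.1 < q.2 then (if F.Adj q.1 q.2 then W x y else 1 - W x y) else 1

lemma indKer_eq_pairProd {k : ℕ} (F : SimpleGraph (Fin k)) (W : ℝ → ℝ → ℝ) :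
    indKer F W = pairProd (fac F W) := by
  ext x
  unfold indKer pairProd fac
  rw [← Finset.univ_product_univ, Finset.prod_product]

lemma fac_meas {k : ℕ} (F : SimpleGraph (Fin k)) {W : ℝ → ℝ → ℝ} (hW : IsGraphon W)
    (q : Fin k × Fin k) : Measurable (Function.uncurry (fac F W q)) := by
  have h := hW.1
  unfold fac
  by_cases h1 : q.1 < q.2
  · by_cases h2 : F.Adj q.1 q.2
    · simp only [h1, h2, if_true]; exact h
    · simp only [h1, h2, if_true, if_false]; exact measurable_const.sub h
  · simp only [h1, if_false]; exact measurable_const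

lemma fac_mem {k : ℕ} (F : SimpleGraph (Fin k)) {W : ℝ → ℝ → ℝ} (hW : IsGraphon W)
    (q : Fin k × Fin k) (x y : ℝ) : 0 ≤ fac F W q x y ∧ fac F W q x y ≤ 1 := by
  have h := hW.2.2 x y
  unfold fac
  split_ifs
  · exact h
  · exact ⟨by linarith [h.2], by linarith [h.1]⟩
  · norm_num

lemma cutNorm_neg (D : ℝ → ℝ → ℝ) : cutNorm (fun x y => - D x y) = cutNorm D := by
  unfold cutNorm
  simp_rw [integral_neg, abs_neg]

lemma counting {k : ℕ} (F : SimpleGraph (Fin k)) {U W : ℝ → ℝ → ℝ} (hU : IsGraphon U)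
    (hW : IsGraphon W) :
    |indDensity F U - indDensity F W| ≤ k ^ 2 * cutNorm (fun x y => U x y - W x y) := by
  classical
  set d := cutNorm (fun x y => U x y - W x y) with hd
  have hd0 : 0 ≤ d := cutNorm_nonneg _
  let H : Finset (Fin k × Fin k) → Fin k × Fin k → ℝ → ℝ → ℝ := fun s q =>
    if q ∈ s then fac F U q else fac F W q
  have hHm : ∀ s q, Measurable (Function.uncurry (H s q)) := by
    intro s q; simp only [H]; split_ifs
    · exact fac_meas F hU q
    · exact fac_meas F hW q
  have hHb : ∀ s q x y, 0 ≤ H s q x y ∧ H s q x y ≤ 1 := by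
    intro s q x y; simp only [H]; split_ifs
    · exact fac_mem F hU q x y
    · exact fac_mem F hW q x y
  have key : ∀ s : Finset (Fin k × Fin k),
      |∫ x, pairProd (H s) x ∂(Measure.pi fun _ : Fin k => lam) - indDensity F W| ≤ s.card * d := by
    intro s
    induction s using Finset.induction_on with
    | empty =>
      have : H ∅ = fac F W := by ext q; simp [H]
      rw [this, indDensity_eq, indKer_eq_pairProd]
      simp
    | insert p s hp ih =>
      have hstep : |∫ x, pairProd (H (insert p s)) x ∂(Measure.pi fun _ : Fin k => lam) -
          ∫ x, pairProd (H s) x ∂(Measure.pi fun _ : Fin k => lam)| ≤ d := by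
        have hne : ∀ q, q ≠ p → H (insert p s) q = H s q := by
          intro q hq; simp [H, hq]
        have h1 : H (insert p s) p = fac F U p := by simp [H]
        have h2 : H s p = fac F W p := by simp [H, hp]
        by_cases hlt : p.1 < p.2
        · by_cases hadj : F.Adj p.1 p.2
          · refine pairProd_step _ _ _ (hU.bm.sub hW.bm) ?_ p hlt (hHm _) (hHm _) (hHb _) (hHb _) ?_ hne ?_
            · intro x y; rw [hU.2.1 x y, hW.2.1 x y]
            · intro q hq x y; simp only [H]; split_ifs <;> simp [fac, hq]
            · intro x y; rw [h1, h2]; simp [fac, hlt, hadj]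
          · rw [hd, ← cutNorm_neg]
            refine pairProd_step _ _ _ (hU.bm.sub hW.bm).neg ?_ p hlt (hHm _) (hHm _) (hHb _) (hHb _) ?_ hne ?_
            · intro x y; rw [hU.2.1 x y, hW.2.1 x y]
            · intro q hq x y; simp only [H]; split_ifs <;> simp [fac, hq]
            · intro x y; rw [h1, h2]; simp [fac, hlt, hadj]
        · have : H (insert p s) = H s := by
            ext q
            by_cases hq : q = p
            · subst hq; rw [h1, h2]; simp [fac, hlt]
            · rw [hne q hq]
          rw [this]; simpa using hd0
      rw [Finset.card_insert_of_notMem hp]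
      push_cast
      have := abs_sub_le (∫ x, pairProd (H (insert p s)) x ∂(Measure.pi fun _ : Fin k => lam))
        (∫ x, pairProd (H s) x ∂(Measure.pi fun _ : Fin k => lam)) (indDensity F W)
      linarith
  have := key Finset.univ
  have e : H Finset.univ = fac F U := by ext q; simp [H]
  rw [e, ← indKer_eq_pairProd, ← indDensity_eq] at this
  refine this.trans (le_of_eq ?_)
  simp [Finset.card_univ, sq]

lemma probIn_counting (k : ℕ) (R' : GraphProp) : ∃ N : ℝ, 0 ≤ N ∧ ∀ {U W : ℝ → ℝ → ℝ}, IsGraphon U →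
    IsGraphon W → |probIn k U R' - probIn k W R'| ≤ N * cutNorm (fun x y => U x y - W x y) := by
  classical
  refine ⟨Fintype.card (SimpleGraph (Fin k)) * k ^ 2, by positivity, ?_⟩
  intro U W hU hW
  unfold probIn
  rw [← Finset.sum_sub_distrib]
  refine (Finset.abs_sum_le_sum_abs _ _).trans ?_
  refine (Finset.sum_le_card_nsmul _ _ (k ^ 2 * cutNorm (fun x y => U x y - W x y)) fun F _ => ?_).trans ?_
  · split_ifs
    · exact counting F hU hW
    · have := cutNorm_nonneg (fun x y => U x y - W x y)
      simp only [sub_self, abs_zero]; positivity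
  · rw [nsmul_eq_mul, mul_assoc, Finset.card_univ]

/-- Pull back of a graphon along a measure preserving map. -/
lemma pullback_isGraphon {W : ℝ → ℝ → ℝ} (hW : IsGraphon W) (φ : InvMP) :
    IsGraphon (fun x y => W (φ.toFun x) (φ.toFun y)) := by
  have hφ := φ.measurePreserving.measurable
  exact ⟨measurable_graphon hW (hφ.comp measurable_fst) (hφ.comp measurable_snd),
    fun x y => hW.2.1 _ _, fun x y => hW.2.2 _ _⟩

lemma indDensity_pullback {k : ℕ} (F : SimpleGraph (Fin k)) {W : ℝ → ℝ → ℝ} (hW : IsGraphon W) (φ : InvMP) :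
    indDensity F (fun x y => W (φ.toFun x) (φ.toFun y)) = indDensity F W := by
  have hp : MeasurePreserving (fun (x : Fin k → ℝ) i => φ.toFun (x i))
      (Measure.pi fun _ : Fin k => lam) (Measure.pi fun _ : Fin k => lam) :=
    measurePreserving_pi (fun _ => lam) (fun _ => lam) fun _ => φ.measurePreserving
  rw [indDensity_eq, indDensity_eq]
  conv_rhs => rw [← hp.map_eq]
  rw [integral_map hp.measurable.aemeasurable (indKer_measurable F hW).aestronglyMeasurable]
  rfl

lemma probIn_pullback (k : ℕ) (R' : GraphProp) {W : ℝ → ℝ → ℝ} (hW : IsGraphon W) (φ : InvMP) :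
    probIn k (fun x y => W (φ.toFun x) (φ.toFun y)) R' = probIn k W R' := by
  unfold probIn
  simp_rw [indDensity_pullback _ hW φ]

/-- The identity as an invertible measure preserving map. -/
def idMP : InvMP where
  toFun := id
  invFun := id
  maps := fun _ h => h
  mapsInv := fun _ h => h
  measurePreserving := MeasurePreserving.id _
  measurePreservingInv := MeasurePreserving.id _
  leftInv := fun _ _ => rfl
  rightInv := fun _ _ => rfl

lemma deltaCut_le (U W : ℝ → ℝ → ℝ) : deltaCut U W ≤ cutNorm (fun x y => U x y - W x y) :=
  ciInf_le (f := fun φ : InvMP => cutNorm (fun x y => U x y - W (φ.toFun x) (φ.toFun y)))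
    ⟨0, by rintro _ ⟨φ, rfl⟩; exact cutNorm_nonneg _⟩ idMP

lemma deltaCut_nonneg (U W : ℝ → ℝ → ℝ) : 0 ≤ deltaCut U W :=
  Real.iInf_nonneg fun _ => cutNorm_nonneg _

lemma probIn_delta (k : ℕ) (R' : GraphProp) : ∃ N : ℝ, 0 ≤ N ∧ ∀ {U W : ℝ → ℝ → ℝ}, IsGraphon U →
    IsGraphon W → probIn k U R' ≤ probIn k W R' + N * deltaCut U W := by
  obtain ⟨N, hN, h⟩ := probIn_counting k R'
  refine ⟨N, hN, fun {U W} hU hW => ?_⟩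
  have : Nonempty InvMP := ⟨idMP⟩
  refine le_of_forall_pos_le_add fun δ hδ => ?_
  have h1 : deltaCut U W < deltaCut U W + δ / (N + 1) := by
    have : 0 < δ / (N + 1) := by positivity
    linarith
  obtain ⟨φ, hφ⟩ := exists_lt_of_ciInf_lt h1
  have h2 := (abs_le.1 (h hU (pullback_isGraphon hW φ))).2
  rw [probIn_pullback k R' hW φ] at h2
  have h3 : N * cutNorm (fun x y => U x y - W (φ.toFun x) (φ.toFun y)) ≤
      N * (deltaCut U W + δ / (N + 1)) := by gcongr
  have h4 : N * (δ / (N + 1)) ≤ δ := by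
    rw [mul_div_assoc', div_le_iff₀ (by positivity)]; nlinarith
  have h5 : N * (deltaCut U W + δ / (N + 1)) = N * deltaCut U W + N * (δ / (N + 1)) := by ring
  linarith

/-- Adjacency indicator. -/
def adjI {n : ℕ} (i j : Fin n) (H : SimpleGraph (Fin n)) : ℝ := ind {H | H.Adj i j} H

lemma adjI_cases {n : ℕ} (i j : Fin n) (H : SimpleGraph (Fin n)) :
    (H.Adj i j ∧ adjI i j H = 1) ∨ (¬ H.Adj i j ∧ adjI i j H = 0) := by
  by_cases h : H.Adj i j
  · left; exact ⟨h, by unfold adjI ind; exact if_pos h⟩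
  · right; exact ⟨h, by unfold adjI ind; exact if_neg h⟩

lemma adjI_abs {n : ℕ} (i j : Fin n) (H : SimpleGraph (Fin n)) : |adjI i j H| ≤ 1 := ind_abs _ _

lemma adjI_gr_meas {n : ℕ} {U : ℝ → ℝ → ℝ} (hU : IsGraphon U) (i j : Fin n) :
    Measurable fun ω => adjI i j (gr U ω) := ind_gr_measurable hU _

lemma adj_update {n : ℕ} {U : ℝ → ℝ → ℝ} (hU : IsGraphon U) {i j : Fin n} (hij : i ≠ j)
    (ω : Fin n ⊕ Sym2 (Fin n) → ℝ) (t : ℝ) :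
    adjI i j (gr U (Function.update ω (Sum.inr s(i, j)) t))
      = chi (Set.Iic (U (ω (Sum.inl i)) (ω (Sum.inl j)))) t := by
  have h : (gr U (Function.update ω (Sum.inr s(i, j)) t)).Adj i j ↔
      t ∈ Set.Iic (U (ω (Sum.inl i)) (ω (Sum.inl j))) := by
    rw [gr_adj hU]
    simp [hij]
  rcases adjI_cases i j (gr U (Function.update ω (Sum.inr s(i, j)) t)) with ⟨h1, h2⟩ | ⟨h1, h2⟩
  · rw [h2]; unfold chi; rw [Set.indicator_of_mem (h.1 h1)]
  · rw [h2]; unfold chi; rw [Set.indicator_of_notMem (fun h' => h1 (h.2 h'))]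

lemma int_chi {u : ℝ} (hu : u ∈ Set.Icc (0:ℝ) 1) : ∫ t, chi (Set.Iic u) t ∂lam = u := by
  unfold chi
  rw [integral_indicator measurableSet_Iic]
  simp only [integral_const, smul_eq_mul, mul_one]
  rw [measureReal_restrict_apply_univ]
  exact lam_le hu

lemma chi_integrable {u : ℝ} : Integrable (fun t => chi (Set.Iic u) t) lam :=
  integrable_bdd (chi_UF measurableSet_Iic).1 1 (chi_UF measurableSet_Iic).abs

lemma int_chi_dist {u g : ℝ} (hu : u ∈ Set.Icc (0:ℝ) 1) (hg : g = 0 ∨ g = 1) :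
    ∫ t, |g - chi (Set.Iic u) t| ∂lam = |g - u| := by
  rcases hg with rfl | rfl
  · simp_rw [zero_sub, abs_neg]
    rw [abs_of_nonneg hu.1]
    conv_rhs => rw [← int_chi hu]
    congr 1; ext t
    exact abs_of_nonneg ((chi_UF measurableSet_Iic).2 t).1
  · have : ∀ t, |1 - chi (Set.Iic u) t| = 1 - chi (Set.Iic u) t := fun t =>
      abs_of_nonneg (by linarith [((chi_UF (S := Set.Iic u) measurableSet_Iic).2 t).2])
    simp_rw [this]
    rw [integral_sub (integrable_const _) chi_integrable, int_chi hu, abs_of_nonneg (by linarith [hu.2])]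
    simp

lemma int_two {n : ℕ} {i j : Fin n} (hij : i ≠ j) {D : ℝ → ℝ → ℝ} (hD : BM D) :
    ∫ ω, D (ω (Sum.inl i)) (ω (Sum.inl j)) ∂(SM n) = ∫ x, ∫ y, D x y ∂(nu n j) ∂(nu n i) := by
  obtain ⟨C, hC⟩ := hD.2
  obtain ⟨C', hC'⟩ := hD.int_bdd (ν := nu n j)
  have hne : (Sum.inl i : Fin n ⊕ Sym2 (Fin n)) ≠ Sum.inl j := fun h => hij (Sum.inl_injective h)
  unfold SM
  have hm2 : Measurable (fun ω : Fin n ⊕ Sym2 (Fin n) → ℝ => (ω (Sum.inl i), ω (Sum.inl j))) :=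
    (measurable_pi_apply _).prodMk (measurable_pi_apply _)
  rw [integral_resample _ (Sum.inl j) (fun ω => D (ω (Sum.inl i)) (ω (Sum.inl j))) (hD.1.comp hm2) C (fun ω => hC _ _)]
  simp only [Function.update_self, Function.update_of_ne hne]
  rw [integral_resample _ (Sum.inl i) (fun ω => ∫ t, D (ω (Sum.inl i)) t ∂(smp (nu n) (Sum.inl j)))
    (hD.int_meas.comp (measurable_pi_apply _)) C' (fun ω => hC' _)]
  simp only [Function.update_self]
  rw [integral_const]
  simp
  rfl

lemma edit_pair {n : ℕ} {U : ℝ → ℝ → ℝ} (hU : IsGraphon U) (G : SimpleGraph (Fin n)) (i j : Fin n) :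
    ∫ ω, |adjI i j G - adjI i j (gr U ω)| ∂(SM n) ≤
      ∫ x, ∫ y, |graphonOf G x y - U x y| ∂(nu n j) ∂(nu n i) := by
  by_cases hij : i = j
  · subst hij
    have : ∀ H : SimpleGraph (Fin n), adjI i i H = 0 := fun H => by
      rcases adjI_cases i i H with ⟨h, _⟩ | ⟨_, h⟩
      · exact absurd rfl h.ne
      · exact h
    simp only [this, sub_self, abs_zero, integral_zero]
    exact integral_nonneg fun x => integral_nonneg fun y => abs_nonneg _
  · set g := adjI i j G with hg
    have hg01 : g = 0 ∨ g = 1 := by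
      rcases adjI_cases i j G with ⟨_, h⟩ | ⟨_, h⟩
      · right; exact h
      · left; exact h
    have hD : BM (fun x y => |g - U x y|) := by
      have : BM (fun _ _ : ℝ => g) := ⟨measurable_const, |g|, fun _ _ => le_refl _⟩
      exact (this.sub hU.bm).abs
    have h1 : ∫ ω, |g - adjI i j (gr U ω)| ∂(SM n) = ∫ ω, |g - U (ω (Sum.inl i)) (ω (Sum.inl j))| ∂(SM n) := by
      unfold SM
      rw [integral_resample _ (Sum.inr s(i, j)) (fun ω => |g - adjI i j (gr U ω)|)
        (measurable_norm.comp (measurable_const.sub (adjI_gr_meas hU i j))) 2 (fun ω => by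
          rw [abs_abs]
          have h1 := adjI_abs i j G
          have h2 := adjI_abs i j (gr U ω)
          have := abs_sub (adjI i j G) (adjI i j (gr U ω))
          rw [hg]; linarith)]
      congr 1
      ext ω
      simp_rw [adj_update hU hij]
      exact int_chi_dist (hU.2.2 _ _) hg01
    rw [h1, int_two hij hD]
    apply le_of_eq
    refine integral_congr_ae ?_
    filter_upwards [nu_ae i] with x hx
    refine integral_congr_ae ?_
    filter_upwards [nu_ae j] with y hy
    rw [graphonOf_strat G hx hy]
    rfl

lemma graphD1_eq {n : ℕ} (G H : SimpleGraph (Fin n)) :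
    graphD1 G H = 1 / 2 * (∑ i, ∑ j, |adjI i j G - adjI i j H|) / n ^ 2 := by
  classical
  set K := (G \ H) ⊔ (H \ G) with hK
  have hKe : symmDiff G.edgeSet H.edgeSet = K.edgeSet := by
    rw [hK, SimpleGraph.edgeSet_sup, SimpleGraph.edgeSet_sdiff, SimpleGraph.edgeSet_sdiff]; rfl
  have hcard : (symmDiff G.edgeSet H.edgeSet).ncard = K.edgeFinset.card := by
    rw [hKe, ← SimpleGraph.coe_edgeFinset, Set.ncard_coe_finset]
  have h2 : 2 * K.edgeFinset.card = (Finset.univ.filter fun x : Fin n × Fin n => K.Adj x.1 x.2).card := by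
    convert K.two_mul_card_edgeFinset
  have hsum : ∑ i, ∑ j, |adjI i j G - adjI i j H| = 2 * K.edgeFinset.card := by
    have : (2 : ℝ) * K.edgeFinset.card = ((2 * K.edgeFinset.card : ℕ) : ℝ) := by push_cast; ring
    rw [this, h2, Finset.card_filter, ← Finset.univ_product_univ, Finset.sum_product]
    push_cast
    refine Finset.sum_congr rfl fun i _ => Finset.sum_congr rfl fun j _ => ?_
    have hadj : K.Adj i j ↔ (G.Adj i j ∧ ¬ H.Adj i j) ∨ (H.Adj i j ∧ ¬ G.Adj i j) := by
      simp [hK]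
    rcases adjI_cases i j G with ⟨a, b⟩ | ⟨a, b⟩ <;> rcases adjI_cases i j H with ⟨c, d⟩ | ⟨c, d⟩ <;>
      simp [hadj, a, b, c, d]
  unfold graphD1
  rw [hcard, hsum]
  ring

lemma edit_expect {n : ℕ} (hn : 0 < n) {U : ℝ → ℝ → ℝ} (hU : IsGraphon U) (G : SimpleGraph (Fin n)) :
    ∫ ω, graphD1 G (gr U ω) ∂(SM n) ≤ l1Norm (fun x y => graphonOf G x y - U x y) / 2 := by
  have hn' : (0 : ℝ) < n := by exact_mod_cast hn
  have hIntg : ∀ i j : Fin n, Integrable (fun ω => |adjI i j G - adjI i j (gr U ω)|) (SM n) := by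
    intro i j
    refine integrable_bdd (measurable_norm.comp (measurable_const.sub (adjI_gr_meas hU i j))) 2 (fun ω => ?_)
    rw [abs_abs]
    have h1 := adjI_abs i j G
    have h2 := adjI_abs i j (gr U ω)
    have := abs_sub (adjI i j G) (adjI i j (gr U ω))
    linarith
  simp_rw [graphD1_eq]
  rw [integral_div, integral_const_mul, integral_finsetSum _ fun i _ => integrable_finsetSum _ fun j _ => hIntg i j]
  simp_rw [integral_finsetSum _ fun j _ => hIntg _ j]
  have hD := ((graphonOf_isGraphon G).bm.sub hU.bm).abs
  obtain ⟨C, hC⟩ := hD.2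
  have h2 := integral_lam_eq₂ hn _ hD.1 C hC
  rw [l1Norm_eq]
  have : ∑ i, ∑ j, ∫ ω, |adjI i j G - adjI i j (gr U ω)| ∂(SM n) ≤
      n ^ 2 * ∫ x, ∫ y, |graphonOf G x y - U x y| ∂lam ∂lam := by
    rw [← h2]
    exact Finset.sum_le_sum fun i _ => Finset.sum_le_sum fun j _ => edit_pair hU G i j
  rw [div_le_div_iff₀ (by positivity) (by norm_num)]
  linarith

lemma graphD1_gr_measurable {n : ℕ} {U : ℝ → ℝ → ℝ} (hU : IsGraphon U) (G : SimpleGraph (Fin n)) :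
    Measurable fun ω => graphD1 G (gr U ω) := by
  simp_rw [graphD1_eq]
  refine Measurable.div_const (Measurable.const_mul (Finset.measurable_sum _ fun i _ =>
    Finset.measurable_sum _ fun j _ => ?_) _) _
  exact measurable_norm.comp (measurable_const.sub (adjI_gr_meas hU i j))

lemma graphD1_gr_integrable {n : ℕ} {U : ℝ → ℝ → ℝ} (hU : IsGraphon U) (G : SimpleGraph (Fin n)) :
    Integrable (fun ω => graphD1 G (gr U ω)) (SM n) := by
  simp_rw [graphD1_eq]
  refine ((integrable_finsetSum _ fun i _ => integrable_finsetSum _ fun j _ => ?_).const_mul _).div_const _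
  refine integrable_bdd (measurable_norm.comp (measurable_const.sub (adjI_gr_meas hU i j))) 2 (fun ω => ?_)
  rw [abs_abs]
  have h1 := adjI_abs i j G
  have h2 := adjI_abs i j (gr U ω)
  have := abs_sub (adjI i j G) (adjI i j (gr U ω))
  linarith

lemma adjI_congr {n : ℕ} {i j : Fin n} {H H' : SimpleGraph (Fin n)} (h : H.Adj i j ↔ H'.Adj i j) :
    adjI i j H = adjI i j H' := by
  rcases adjI_cases i j H with ⟨a, b⟩ | ⟨a, b⟩ <;> rcases adjI_cases i j H' with ⟨c, d⟩ | ⟨c, d⟩ <;>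
    rw [b, d]
  · exact absurd (h.1 a) c
  · exact absurd (h.2 c) a

/-- Centered adjacency matrix of the random graph. -/
def cen {n : ℕ} (W : ℝ → ℝ → ℝ) (i j : Fin n) (ω : Fin n ⊕ Sym2 (Fin n) → ℝ) : ℝ :=
  adjI i j (gr W ω) - if i = j then 0 else W (ω (Sum.inl i)) (ω (Sum.inl j))

lemma cen_diag {n : ℕ} (W : ℝ → ℝ → ℝ) (i : Fin n) (ω : Fin n ⊕ Sym2 (Fin n) → ℝ) :
    cen W i i ω = 0 := by
  unfold cen
  rcases adjI_cases i i (gr W ω) with ⟨h, _⟩ | ⟨_, h⟩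
  · exact absurd rfl h.ne
  · simp [h]

lemma cen_meas {n : ℕ} {W : ℝ → ℝ → ℝ} (hW : IsGraphon W) (i j : Fin n) :
    Measurable (cen W i j) := by
  unfold cen
  refine (adjI_gr_meas hW i j).sub ?_
  split_ifs
  · exact measurable_const
  · exact measurable_graphon hW (measurable_pi_apply _) (measurable_pi_apply _)

lemma cen_abs {n : ℕ} {W : ℝ → ℝ → ℝ} (hW : IsGraphon W) (i j : Fin n)
    (ω : Fin n ⊕ Sym2 (Fin n) → ℝ) : |cen W i j ω| ≤ 1 := by
  have h := hW.2.2 (ω (Sum.inl i)) (ω (Sum.inl j))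
  have h1 := h.1
  have h2 := h.2
  unfold cen
  rcases adjI_cases i j (gr W ω) with ⟨_, b⟩ | ⟨_, b⟩ <;> rw [b] <;> split_ifs <;> rw [abs_le] <;>
    constructor <;> linarith

lemma cen_update {n : ℕ} {W : ℝ → ℝ → ℝ} (hW : IsGraphon W) {i j : Fin n} {e : Sym2 (Fin n)}
    (he : s(i, j) ≠ e) (ω : Fin n ⊕ Sym2 (Fin n) → ℝ) (t : ℝ) :
    cen W i j (Function.update ω (Sum.inr e) t) = cen W i j ω := by
  have h1 : ∀ a : Fin n, (Sum.inl a : Fin n ⊕ Sym2 (Fin n)) ≠ Sum.inr e := fun a h => by cases h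
  have h2 : (Sum.inr s(i, j) : Fin n ⊕ Sym2 (Fin n)) ≠ Sum.inr e := fun h => he (Sum.inr_injective h)
  unfold cen
  rw [Function.update_of_ne (h1 i), Function.update_of_ne (h1 j)]
  congr 1
  apply adjI_congr
  rw [gr_adj hW, gr_adj hW, Function.update_of_ne (h1 i), Function.update_of_ne (h1 j),
    Function.update_of_ne h2]

lemma cen_int {n : ℕ} {W : ℝ → ℝ → ℝ} (hW : IsGraphon W) {i j : Fin n} (hij : i ≠ j)
    (ω : Fin n ⊕ Sym2 (Fin n) → ℝ) :
    ∫ t, cen W i j (Function.update ω (Sum.inr s(i, j)) t) ∂lam = 0 := by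
  have h1 : ∀ a : Fin n, (Sum.inl a : Fin n ⊕ Sym2 (Fin n)) ≠ Sum.inr s(i, j) := fun a h => by cases h
  unfold cen
  simp only [if_neg hij, Function.update_of_ne (h1 _), adj_update hW hij]
  rw [integral_sub chi_integrable (integrable_const _), int_chi (hW.2.2 _ _)]
  simp

/-- The four-cycle statistic. -/
def fourQ {n : ℕ} (W : ℝ → ℝ → ℝ) (ω : Fin n ⊕ Sym2 (Fin n) → ℝ) : ℝ :=
  ∑ j : Fin n, ∑ l : Fin n, (∑ i : Fin n, cen W i j ω * cen W i l ω) ^ 2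

lemma fourQ_meas {n : ℕ} {W : ℝ → ℝ → ℝ} (hW : IsGraphon W) : Measurable (fourQ (n := n) W) := by
  unfold fourQ
  exact Finset.measurable_sum _ fun j _ => Finset.measurable_sum _ fun l _ =>
    (Finset.measurable_sum _ fun i _ => (cen_meas hW i j).mul (cen_meas hW i l)).pow_const 2

lemma four_abs {n : ℕ} {W : ℝ → ℝ → ℝ} (hW : IsGraphon W) (i j k l : Fin n)
    (ω : Fin n ⊕ Sym2 (Fin n) → ℝ) :
    |cen W i j ω * cen W i l ω * (cen W k j ω * cen W k l ω)| ≤ 1 := by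
  rw [abs_mul, abs_mul, abs_mul]
  have h := fun a b => cen_abs hW a b ω
  have h0 := fun a b => abs_nonneg (cen W (n := n) a b ω)
  exact mul_le_one₀ (mul_le_one₀ (h _ _) (h0 _ _) (h _ _)) (by have := h0 k j; have := h0 k l; positivity)
    (mul_le_one₀ (h _ _) (h0 _ _) (h _ _))

lemma four_meas {n : ℕ} {W : ℝ → ℝ → ℝ} (hW : IsGraphon W) (i j k l : Fin n) :
    Measurable fun ω => cen W i j ω * cen W i l ω * (cen W k j ω * cen W k l ω) :=
  ((cen_meas hW i j).mul (cen_meas hW i l)).mul ((cen_meas hW k j).mul (cen_meas hW k l))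

lemma four_int {n : ℕ} {W : ℝ → ℝ → ℝ} (hW : IsGraphon W) {i j k l : Fin n} (hik : i ≠ k) (hjl : j ≠ l) :
    ∫ ω, cen W i j ω * cen W i l ω * (cen W k j ω * cen W k l ω) ∂(SM n) = 0 := by
  by_cases h1 : i = j
  · subst h1; simp [cen_diag]
  by_cases h2 : i = l
  · subst h2; simp [cen_diag]
  by_cases h3 : k = j
  · subst h3; simp [cen_diag]
  unfold SM
  rw [integral_resample _ (Sum.inr s(i, j)) _ (four_meas hW i j k l) 1 (four_abs hW i j k l)]
  have e1 : s(i, l) ≠ s(i, j) := by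
    intro h; rw [Sym2.eq_iff] at h
    rcases h with ⟨_, h⟩ | ⟨h, _⟩
    · exact hjl h.symm
    · exact h1 h
  have e2 : s(k, j) ≠ s(i, j) := by
    intro h; rw [Sym2.eq_iff] at h
    rcases h with ⟨h, _⟩ | ⟨h, _⟩
    · exact hik h.symm
    · exact h3 h
  have e3 : s(k, l) ≠ s(i, j) := by
    intro h; rw [Sym2.eq_iff] at h
    rcases h with ⟨h, _⟩ | ⟨h, _⟩
    · exact hik h.symm
    · exact h3 h
  simp_rw [cen_update hW e1, cen_update hW e2, cen_update hW e3, integral_mul_const]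
  have : ∀ ω : Fin n ⊕ Sym2 (Fin n) → ℝ, ∫ t, cen W i j (Function.update ω (Sum.inr s(i, j)) t)
      ∂(smp (nu n) (Sum.inr s(i, j))) = 0 := fun ω => cen_int hW h1 ω
  simp [this]

lemma fourQ_eq {n : ℕ} (W : ℝ → ℝ → ℝ) (ω : Fin n ⊕ Sym2 (Fin n) → ℝ) :
    fourQ W ω = ∑ j : Fin n, ∑ l : Fin n, ∑ i : Fin n, ∑ k : Fin n,
      cen W i j ω * cen W i l ω * (cen W k j ω * cen W k l ω) := by
  unfold fourQ
  simp_rw [sq, Finset.sum_mul_sum]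

lemma fourQ_integrable {n : ℕ} {W : ℝ → ℝ → ℝ} (hW : IsGraphon W) : Integrable (fourQ W) (SM n) := by
  have : fourQ (n := n) W = fun ω => ∑ j : Fin n, ∑ l : Fin n, ∑ i : Fin n, ∑ k : Fin n,
      cen W i j ω * cen W i l ω * (cen W k j ω * cen W k l ω) := funext (fourQ_eq W)
  rw [this]
  exact integrable_finsetSum _ fun j _ => integrable_finsetSum _ fun l _ => integrable_finsetSum _ fun i _ =>
    integrable_finsetSum _ fun k _ => integrable_bdd (four_meas hW i j k l) 1 (four_abs hW i j k l)

lemma fourQ_int {n : ℕ} {W : ℝ → ℝ → ℝ} (hW : IsGraphon W) :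
    ∫ ω, fourQ W ω ∂(SM n) ≤ 2 * n ^ 3 := by
  have hi := fun i j k l => integrable_bdd (μ := SM n) (four_meas hW i j k l) 1 (four_abs hW i j k l)
  simp_rw [fourQ_eq]
  rw [integral_finsetSum _ fun j _ => integrable_finsetSum _ fun l _ => integrable_finsetSum _ fun i _ =>
    integrable_finsetSum _ fun k _ => hi i j k l]
  have hterm : ∀ j l i k : Fin n, ∫ ω, cen W i j ω * cen W i l ω * (cen W k j ω * cen W k l ω) ∂(SM n) ≤
      (if j = l then 1 else 0) + (if i = k then (1 : ℝ) else 0) := by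
    intro j l i k
    by_cases h : j = l ∨ i = k
    · have h1 := (le_abs_self _).trans (abs_int_le_const (μ := SM n) (four_abs hW i j k l))
      refine h1.trans ?_
      rcases h with h | h <;> simp only [h, if_true] <;> split_ifs <;> norm_num
    · push Not at h
      rw [four_int hW h.2 h.1]
      split_ifs <;> norm_num
  calc _ ≤ ∑ j : Fin n, ∑ l : Fin n, ∑ i : Fin n, ∑ k : Fin n,
        ((if j = l then 1 else 0) + (if i = k then (1 : ℝ) else 0)) := by
        refine Finset.sum_le_sum fun j _ => ?_
        rw [integral_finsetSum _ fun l _ => integrable_finsetSum _ fun i _ =>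
          integrable_finsetSum _ fun k _ => hi i j k l]
        refine Finset.sum_le_sum fun l _ => ?_
        rw [integral_finsetSum _ fun i _ => integrable_finsetSum _ fun k _ => hi i j k l]
        refine Finset.sum_le_sum fun i _ => ?_
        rw [integral_finsetSum _ fun k _ => hi i j k l]
        exact Finset.sum_le_sum fun k _ => hterm j l i k
    _ = 2 * n ^ 3 := by
        simp [Finset.sum_add_distrib]
        ring

/-- Two applications of Cauchy-Schwarz. -/
lemma bilinear_four {n : ℕ} (A : Fin n → Fin n → ℝ) (f g : Fin n → ℝ) (hf : ∀ i, 0 ≤ f i ∧ f i ≤ 1)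
    (hg : ∀ i, 0 ≤ g i ∧ g i ≤ 1) :
    (∑ i, ∑ j, f i * g j * A i j) ^ 4 ≤ n ^ 4 * ∑ j, ∑ l, (∑ i, A i j * A i l) ^ 2 := by
  set Q := ∑ j, ∑ l, (∑ i, A i j * A i l) ^ 2 with hQ
  have h1 : (∑ i, ∑ j, f i * g j * A i j) ^ 2 ≤ n * ∑ j, ∑ l, g j * g l * ∑ i, A i j * A i l := by
    have e : ∑ i, ∑ j, f i * g j * A i j = ∑ i, f i * ∑ j, g j * A i j := by
      simp_rw [Finset.mul_sum, mul_assoc]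
    rw [e]
    refine (Finset.sum_mul_sq_le_sq_mul_sq _ _ _).trans ?_
    have e2 : ∑ i, (∑ j, g j * A i j) ^ 2 = ∑ j, ∑ l, g j * g l * ∑ i, A i j * A i l := by
      simp_rw [sq, Finset.sum_mul_sum, Finset.mul_sum]
      rw [Finset.sum_comm]
      refine Finset.sum_congr rfl fun j _ => ?_
      rw [Finset.sum_comm]
      refine Finset.sum_congr rfl fun l _ => Finset.sum_congr rfl fun i _ => by ring
    rw [← e2]
    refine mul_le_mul_of_nonneg_right ?_ (Finset.sum_nonneg fun i _ => sq_nonneg _)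
    refine (Finset.sum_le_card_nsmul _ _ 1 fun i _ => ?_).trans (by simp)
    exact pow_le_one₀ (hf i).1 (hf i).2
  set T := ∑ j, ∑ l, g j * g l * ∑ i, A i j * A i l with hT
  have h2 : T ^ 2 ≤ n ^ 2 * Q := by
    have e : T = ∑ p : Fin n × Fin n, (g p.1 * g p.2) * ∑ i, A i p.1 * A i p.2 := by
      rw [← Finset.univ_product_univ, Finset.sum_product]
    have e2 : Q = ∑ p : Fin n × Fin n, (∑ i, A i p.1 * A i p.2) ^ 2 := by
      rw [← Finset.univ_product_univ, Finset.sum_product]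
    rw [e, e2]
    refine (Finset.sum_mul_sq_le_sq_mul_sq _ _ _).trans ?_
    refine mul_le_mul_of_nonneg_right ?_ (Finset.sum_nonneg fun i _ => sq_nonneg _)
    refine (Finset.sum_le_card_nsmul _ _ 1 fun p _ => ?_).trans (by simp [sq])
    exact pow_le_one₀ (mul_nonneg (hg _).1 (hg _).1) (mul_le_one₀ (hg _).2 (hg _).1 (hg _).2)
  calc (∑ i, ∑ j, f i * g j * A i j) ^ 4 = ((∑ i, ∑ j, f i * g j * A i j) ^ 2) ^ 2 := by ring
    _ ≤ (n * T) ^ 2 := by gcongr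
    _ = n ^ 2 * T ^ 2 := by ring
    _ ≤ n ^ 2 * (n ^ 2 * Q) := by gcongr
    _ = _ := by ring

lemma exists_cont_approx {W : ℝ → ℝ → ℝ} (hW : IsGraphon W) {δ : ℝ} (hδ : 0 < δ) :
    ∃ V : ℝ → ℝ → ℝ, BM V ∧ l1Norm (fun x y => W x y - V x y) ≤ δ ∧ ∃ r > 0, ∀ x x' y y' : ℝ,
      |x - x'| ≤ r → |y - y'| ≤ r → |V x y - V x' y'| ≤ δ := by
  have hIntg : Integrable (Function.uncurry W) (lam.prod lam) :=
    integrable_bdd hW.1 1 fun p => by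
      have := hW.2.2 p.1 p.2
      show |W p.1 p.2| ≤ 1
      rw [abs_of_nonneg this.1]; exact this.2
  obtain ⟨g, hgs, hg, hgc, hgi⟩ := hIntg.exists_hasCompactSupport_integral_sub_le hδ
  obtain ⟨C, hC⟩ := hgs.exists_bound_of_continuous hgc
  have hV : BM (fun x y => g (x, y)) := ⟨hgc.measurable, C, fun x y => hC _⟩
  refine ⟨fun x y => g (x, y), hV, ?_, ?_⟩
  · rw [l1Norm_eq]
    obtain ⟨h1, C', hC'⟩ := (hW.bm.sub hV).abs
    have := integral_prod (μ := lam) (ν := lam) _ (integrable_bdd h1 C' fun p => hC' p.1 p.2)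
    rw [← (show _ = ∫ x, ∫ y, |W x y - g (x, y)| ∂lam ∂lam from this)]
    exact hg
  · have huc := hgs.uniformContinuous_of_continuous hgc
    obtain ⟨r, hr, h⟩ := Metric.uniformContinuous_iff.1 huc δ hδ
    refine ⟨r / 2, by positivity, fun x x' y y' hx hy => ?_⟩
    have : dist (x, y) (x', y') < r := by
      rw [Prod.dist_eq, max_lt_iff, Real.dist_eq, Real.dist_eq]
      constructor <;> simp only <;> linarith
    have := h this
    rw [Real.dist_eq] at this
    exact this.le

lemma strat_close {n : ℕ} {i : Fin n} {x y : ℝ} (hx : x ∈ strat n i) (hy : y ∈ strat n i) :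
    |x - y| ≤ 1 / n := by
  have hn := fin_pos_real i
  simp only [strat, Set.mem_Ioc] at hx hy
  have h : (((i : ℕ) : ℝ) + 1) / n = ((i : ℕ) : ℝ) / n + 1 / n := by ring
  rw [h] at hx hy
  rw [abs_le]; constructor <;> linarith [hx.1, hx.2, hy.1, hy.2]

/-- The sampled approximation error. -/
def errS {n : ℕ} (W V : ℝ → ℝ → ℝ) (i j : Fin n) (ω : Fin n ⊕ Sym2 (Fin n) → ℝ) : ℝ :=
  if i = j then 0 else |W (ω (Sum.inl i)) (ω (Sum.inl j)) - V (ω (Sum.inl i)) (ω (Sum.inl j))|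

lemma errS_nonneg {n : ℕ} (W V : ℝ → ℝ → ℝ) (i j : Fin n) (ω : Fin n ⊕ Sym2 (Fin n) → ℝ) :
    0 ≤ errS W V i j ω := by
  unfold errS; split_ifs
  · exact le_rfl
  · exact abs_nonneg _

lemma errS_integrable {n : ℕ} {W V : ℝ → ℝ → ℝ} (hW : BM W) (hV : BM V) (i j : Fin n) :
    Integrable (errS W V i j) (SM n) := by
  unfold errS
  split_ifs
  · exact integrable_const _
  · obtain ⟨h, C, hC⟩ := (hW.sub hV).abs
    have hm : Measurable fun ω : Fin n ⊕ Sym2 (Fin n) → ℝ => (ω (Sum.inl i), ω (Sum.inl j)) :=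
      (measurable_pi_apply _).prodMk (measurable_pi_apply _)
    have h2 := h.comp hm
    exact integrable_bdd h2 C fun ω => hC _ _

lemma errS_sum {n : ℕ} (hn : 0 < n) {W V : ℝ → ℝ → ℝ} (hW : BM W) (hV : BM V) :
    ∫ ω, ∑ i : Fin n, ∑ j : Fin n, errS W V i j ω ∂(SM n) ≤
      n ^ 2 * l1Norm (fun x y => W x y - V x y) := by
  rw [integral_finsetSum _ fun i _ => integrable_finsetSum _ fun j _ => errS_integrable hW hV i j]
  simp_rw [fun i => integral_finsetSum (μ := SM n) Finset.univ fun j _ => errS_integrable hW hV i j]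
  have hb := (hW.sub hV).abs
  obtain ⟨h, C, hC⟩ := hb
  rw [l1Norm_eq, ← integral_lam_eq₂ hn _ h C hC]
  refine Finset.sum_le_sum fun i _ => Finset.sum_le_sum fun j _ => ?_
  by_cases hij : i = j
  · simp only [errS, hij, if_true, integral_zero]
    exact integral_nonneg fun x => integral_nonneg fun y => abs_nonneg _
  · simp only [errS, hij, if_false]
    rw [int_two (D := fun x y => |W x y - V x y|) hij (hW.sub hV).abs]

lemma block_bound {n : ℕ} {W V : ℝ → ℝ → ℝ} (hW : IsGraphon W) (hV : BM V) {δ r : ℝ} (hδ : 0 < δ)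
    (hr : 1 / (n : ℝ) ≤ r) (hVr : ∀ x x' y y' : ℝ, |x - x'| ≤ r → |y - y'| ≤ r → |V x y - V x' y'| ≤ δ)
    {f g : ℝ → ℝ} (hf : UF f) (hg : UF g)
    (ω : Fin n ⊕ Sym2 (Fin n) → ℝ) (hω : ∀ i, ω (Sum.inl i) ∈ strat n i) (i j : Fin n) :
    |(∫ x, ∫ y, f x * g y * (graphonOf (gr W ω) x y - W x y) ∂(nu n j) ∂(nu n i))
      - (∫ x, f x ∂(nu n i)) * (∫ y, g y ∂(nu n j)) * cen W i j ω| ≤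
    errS W V i j ω + δ + (if i = j then 1 else 0)
      + ∫ x, ∫ y, |W x y - V x y| ∂(nu n j) ∂(nu n i) := by
  set K := errS W V i j ω + δ + (if i = j then 1 else 0) with hK
  have hWb := hW.bm
  have hD := ((graphonOf_isGraphon (gr W ω)).bm.sub hWb).mul hf hg
  have hc : BM (fun _ _ : ℝ => cen W i j ω) := ⟨measurable_const, |cen W i j ω|, fun _ _ => le_rfl⟩
  have hc' := hc.mul hf hg
  have hKc : BM (fun _ _ : ℝ => K) := ⟨measurable_const, |K|, fun _ _ => le_rfl⟩
  have hE := hKc.add (hWb.sub hV).abs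
  have e1 : (∫ x, f x ∂(nu n i)) * (∫ y, g y ∂(nu n j)) * cen W i j ω
      = ∫ x, ∫ y, f x * g y * cen W i j ω ∂(nu n j) ∂(nu n i) := by
    simp_rw [integral_mul_const, integral_const_mul]
    rw [integral_mul_const]
  have e2 : ∫ x, ∫ y, (K + |W x y - V x y|) ∂(nu n j) ∂(nu n i)
      = K + ∫ x, ∫ y, |W x y - V x y| ∂(nu n j) ∂(nu n i) := by
    simp_rw [fun x => integral_add (integrable_const K) ((hWb.sub hV).abs.row x (μ := nu n j))]
    rw [integral_add (by simp) (hWb.sub hV).abs.int_int]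
    simp
  rw [e1, ← e2, ← integral_sub hD.int_int hc'.int_int]
  simp_rw [fun x => (integral_sub (hD.row x (μ := nu n j)) (hc'.row x)).symm]
  refine (hD.sub hc').int_abs.trans ?_
  refine integral_mono_ae (hD.sub hc').abs.int_int hE.int_int ?_
  filter_upwards [nu_ae i] with x hx
  refine integral_mono_ae ((hD.sub hc').abs.row x) (hE.row x) ?_
  filter_upwards [nu_ae j] with y hy
  have hG : graphonOf (gr W ω) x y = adjI i j (gr W ω) := graphonOf_strat _ hx hy
  simp only [hG]
  rw [← mul_sub, abs_mul]
  have h1 : |f x * g y| ≤ 1 := by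
    rw [abs_mul]; exact mul_le_one₀ (hf.abs x) (abs_nonneg _) (hg.abs y)
  refine (mul_le_of_le_one_left (abs_nonneg _) h1).trans ?_
  have hx' := hVr (ω (Sum.inl i)) x (ω (Sum.inl j)) y ((strat_close (hω i) hx).trans hr)
    ((strat_close (hω j) hy).trans hr)
  by_cases hij : i = j
  · have hw := hW.2.2 x y
    have : |W x y| ≤ 1 := by rw [abs_of_nonneg hw.1]; exact hw.2
    have e : adjI i j (gr W ω) - W x y - cen W i j ω = - W x y := by
      simp [cen, hij]
    rw [e, abs_neg, hK]
    simp only [hij, if_true]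
    have := errS_nonneg W V j j ω
    have := abs_nonneg (W x y - V x y)
    linarith
  · have e : adjI i j (gr W ω) - W x y - cen W i j ω =
      (W (ω (Sum.inl i)) (ω (Sum.inl j)) - V (ω (Sum.inl i)) (ω (Sum.inl j)))
      + (V (ω (Sum.inl i)) (ω (Sum.inl j)) - V x y) - (W x y - V x y) := by
      simp only [cen, hij, if_false]; ring
    rw [e, hK]
    simp only [errS, hij, if_false]
    refine (abs_sub _ _).trans ?_
    have := abs_add_le (W (ω (Sum.inl i)) (ω (Sum.inl j)) - V (ω (Sum.inl i)) (ω (Sum.inl j)))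
      (V (ω (Sum.inl i)) (ω (Sum.inl j)) - V x y)
    linarith

lemma cut_det {n : ℕ} (hn : 0 < n) {W V : ℝ → ℝ → ℝ} (hW : IsGraphon W) (hV : BM V) {δ r : ℝ} (hδ : 0 < δ)
    (hr : 1 / (n : ℝ) ≤ r) (hVr : ∀ x x' y y' : ℝ, |x - x'| ≤ r → |y - y'| ≤ r → |V x y - V x' y'| ≤ δ)
    (ω : Fin n ⊕ Sym2 (Fin n) → ℝ) (hω : ∀ i, ω (Sum.inl i) ∈ strat n i)
    (hQ : fourQ W ω ≤ n ^ 4 * δ ^ 4) (hS : ∑ i, ∑ j, errS W V i j ω ≤ n ^ 2 * δ)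
    (hnδ : 1 / (n : ℝ) ≤ δ) (hWV : l1Norm (fun x y => W x y - V x y) ≤ δ) :
    cutNorm (fun x y => graphonOf (gr W ω) x y - W x y) ≤ 5 * δ := by
  have hn' : (0 : ℝ) < n := by exact_mod_cast hn
  refine cutNorm_le fun S T hS' hT' => ?_
  have hf := chi_UF hS'
  have hg := chi_UF hT'
  set f := chi S
  set g := chi T
  obtain ⟨h, C, hC⟩ := ((graphonOf_isGraphon (gr W ω)).bm.sub hW.bm).mul hf hg
  have e1 := integral_lam_eq₂ hn _ h C hC
  obtain ⟨h2, C2, hC2⟩ := (hW.bm.sub hV).abs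
  have e2 := integral_lam_eq₂ hn _ h2 C2 hC2
  rw [← l1Norm_eq] at e2
  have hav : ∀ (f : ℝ → ℝ), UF f → ∀ i : Fin n, 0 ≤ ∫ x, f x ∂(nu n i) ∧ ∫ x, f x ∂(nu n i) ≤ 1 := by
    intro f hf i
    refine ⟨integral_nonneg fun x => (hf.2 x).1, ?_⟩
    exact (le_abs_self _).trans (abs_int_le_const hf.abs)
  have h4 := bilinear_four (fun i j => cen W i j ω) _ _ (hav f hf) (hav g hg)
  set M := ∑ i, ∑ j, (∫ x, f x ∂(nu n i)) * (∫ y, g y ∂(nu n j)) * cen W i j ω with hM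
  have hM4 : M ^ 4 ≤ (n ^ 2 * δ) ^ 4 := by
    refine h4.trans ?_
    calc (n : ℝ) ^ 4 * fourQ W ω ≤ n ^ 4 * (n ^ 4 * δ ^ 4) := by gcongr
      _ = _ := by ring
  have hMabs : |M| ≤ n ^ 2 * δ := by
    refine abs_le_of_sq_le_sq' ?_ (by positivity) |> abs_le.2
    have : (M ^ 2) ^ 2 ≤ ((n ^ 2 * δ) ^ 2) ^ 2 := by nlinarith [hM4]
    exact (abs_le_of_sq_le_sq' this (by positivity)).2
  have hbb := fun i j => block_bound hW hV hδ hr hVr hf hg ω hω i j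
  have hsum : |∑ i, ∑ j, ((∫ x, ∫ y, f x * g y * (graphonOf (gr W ω) x y - W x y) ∂(nu n j) ∂(nu n i))
      - (∫ x, f x ∂(nu n i)) * (∫ y, g y ∂(nu n j)) * cen W i j ω)| ≤
      ∑ i, ∑ j, (errS W V i j ω + δ + (if i = j then 1 else 0)
      + ∫ x, ∫ y, |W x y - V x y| ∂(nu n j) ∂(nu n i)) := by
    refine (Finset.abs_sum_le_sum_abs _ _).trans (Finset.sum_le_sum fun i _ => ?_)
    exact (Finset.abs_sum_le_sum_abs _ _).trans (Finset.sum_le_sum fun j _ => hbb i j)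
  simp only [Finset.sum_sub_distrib, Finset.sum_add_distrib] at hsum
  rw [e1, e2, ← hM] at hsum
  have hc : ∑ i : Fin n, ∑ j : Fin n, (if i = j then (1:ℝ) else 0) = n := by simp
  have hd : ∑ i : Fin n, ∑ j : Fin n, δ = n ^ 2 * δ := by simp; ring
  rw [hc, hd] at hsum
  have hfin : |(n:ℝ) ^ 2 * cutInt f g (fun x y => graphonOf (gr W ω) x y - W x y)| ≤ n ^ 2 * (5 * δ) := by
    have ht := abs_sub_abs_le_abs_sub ((n:ℝ) ^ 2 * cutInt f g (fun x y => graphonOf (gr W ω) x y - W x y)) M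
    have h5 : (n : ℝ) ≤ n ^ 2 * δ := by
      rw [div_le_iff₀ hn'] at hnδ
      nlinarith
    have h6 : (n : ℝ) ^ 2 * l1Norm (fun x y => W x y - V x y) ≤ n ^ 2 * δ := by gcongr
    have := ht.trans hsum
    linarith
  rw [abs_mul, abs_of_pos (by positivity : (0:ℝ) < n ^ 2)] at hfin
  exact le_of_mul_le_mul_left hfin (by positivity)

lemma SM_ae (n : ℕ) : ∀ᵐ ω ∂(SM n), ∀ i : Fin n, ω (Sum.inl i) ∈ strat n i := by
  rw [ae_all_iff]
  intro i
  have h := (measurePreserving_eval (smp (nu n)) (Sum.inl i)).quasiMeasurePreserving.ae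
    (p := fun x => x ∈ strat n i) (nu_ae i)
  exact h

lemma cut_sample {W : ℝ → ℝ → ℝ} (hW : IsGraphon W) {η : ℝ} (hη : 0 < η) :
    ∃ N : ℕ, ∀ n ≥ N, 0 < n → ∃ Y : (Fin n ⊕ Sym2 (Fin n) → ℝ) → ℝ, Integrable Y (SM n) ∧
      (∀ ω, 0 ≤ Y ω) ∧ ∫ ω, Y ω ∂(SM n) ≤ 1 / 4 ∧
      ∀ᵐ ω ∂(SM n), Y ω < 1 → cutNorm (fun x y => graphonOf (gr W ω) x y - W x y) ≤ η := by
  set δ := η / 5 with hδd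
  have hδ : 0 < δ := by positivity
  obtain ⟨V, hV, hWV, r, hr, hVr⟩ := exists_cont_approx hW (show 0 < δ / 8 by positivity)
  obtain ⟨N, hN⟩ := exists_nat_gt (max (1 / r) (max (1 / δ) (16 / δ ^ 4)))
  refine ⟨N, fun n hnN hn => ?_⟩
  have hn' : (0 : ℝ) < n := by exact_mod_cast hn
  have hNn : (N : ℝ) ≤ n := by exact_mod_cast hnN
  have hb := hN.trans_le hNn
  rw [max_lt_iff, max_lt_iff] at hb
  obtain ⟨b1, b2, b3⟩ := hb
  have c1 : 1 / (n:ℝ) ≤ r := by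
    rw [div_lt_iff₀ hr] at b1; rw [div_le_iff₀ hn']; linarith
  have c2 : 1 / (n:ℝ) ≤ δ := by
    rw [div_lt_iff₀ hδ] at b2; rw [div_le_iff₀ hn']; linarith
  have hδ4 : 0 < δ ^ 4 := by positivity
  have c3 : 16 ≤ n * δ ^ 4 := by
    rw [div_lt_iff₀ hδ4] at b3; exact b3.le
  have hSi : Integrable (fun ω => ∑ i : Fin n, ∑ j : Fin n, errS W V i j ω) (SM n) :=
    integrable_finsetSum _ fun i _ => integrable_finsetSum _ fun j _ => errS_integrable hW.bm hV i j
  have hQ0 : ∀ ω, 0 ≤ fourQ (n := n) W ω := fun ω =>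
    Finset.sum_nonneg fun j _ => Finset.sum_nonneg fun l _ => sq_nonneg _
  have hS0 : ∀ ω, 0 ≤ ∑ i : Fin n, ∑ j : Fin n, errS W V i j ω := fun ω =>
    Finset.sum_nonneg fun j _ => Finset.sum_nonneg fun l _ => errS_nonneg _ _ _ _ _
  refine ⟨fun ω => fourQ W ω / (n ^ 4 * δ ^ 4) + (∑ i : Fin n, ∑ j : Fin n, errS W V i j ω) / (n ^ 2 * δ),
    ((fourQ_integrable hW).div_const _).add (hSi.div_const _), fun ω => ?_, ?_, ?_⟩
  · have := hQ0 ω; have := hS0 ω; positivity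
  · rw [integral_add ((fourQ_integrable hW).div_const _) (hSi.div_const _), integral_div, integral_div]
    have h1 : (∫ ω, fourQ W ω ∂(SM n)) / (n ^ 4 * δ ^ 4) ≤ 1 / 8 := by
      rw [div_le_iff₀ (by positivity)]
      refine (fourQ_int hW).trans ?_
      have : (n:ℝ) ^ 3 * 16 ≤ n ^ 3 * (n * δ ^ 4) := by gcongr
      nlinarith
    have h2 : (∫ ω, ∑ i : Fin n, ∑ j : Fin n, errS W V i j ω ∂(SM n)) / (n ^ 2 * δ) ≤ 1 / 8 := by
      rw [div_le_iff₀ (by positivity)]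
      refine (errS_sum hn hW.bm hV).trans ?_
      have : (n:ℝ) ^ 2 * l1Norm (fun x y => W x y - V x y) ≤ n ^ 2 * (δ / 8) := by gcongr
      linarith
    linarith
  · filter_upwards [SM_ae n] with ω hω hY
    have hq := hQ0 ω
    have hs := hS0 ω
    have t1 : 0 ≤ fourQ W ω / (n ^ 4 * δ ^ 4) := by positivity
    have t2 : 0 ≤ (∑ i : Fin n, ∑ j : Fin n, errS W V i j ω) / (n ^ 2 * δ) := by positivity
    have u1 : fourQ W ω / (n ^ 4 * δ ^ 4) ≤ 1 := by linarith
    have u2 : (∑ i : Fin n, ∑ j : Fin n, errS W V i j ω) / (n ^ 2 * δ) ≤ 1 := by linarith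
    rw [div_le_iff₀ (by positivity), one_mul] at u1 u2
    have := cut_det hn hW hV hδ c1 (fun x x' y y' hx hy => (hVr x x' y y' hx hy).trans (by linarith))
      ω hω u1 u2 c2 (hWV.trans (by linarith))
    rw [hδd] at this
    linarith

/-- Slowly growing scale. -/
def mm (k : ℕ) : ℕ := Nat.findGreatest (fun m => 10000 * m ^ 3 ≤ k) k

lemma mm_spec (k : ℕ) : 10000 * mm k ^ 3 ≤ k :=
  Nat.findGreatest_spec (P := fun m => 10000 * m ^ 3 ≤ k) (m := 0) (Nat.zero_le _) (by simp)

lemma le_mm {j k : ℕ} (h : 10000 * j ^ 3 ≤ k) : j ≤ mm k := by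
  refine Nat.le_findGreatest ?_ h
  have : j ≤ j ^ 3 := Nat.le_self_pow (by norm_num) j
  omega

lemma mm_mono {k n : ℕ} (h : k ≤ n) : mm k ≤ mm n := le_mm ((mm_spec k).trans h)

lemma mm_sq {j k : ℕ} (hj : j ≤ mm k) : 8 * j ^ 2 ≤ k := by
  have h1 := mm_spec k
  have h2 : j ^ 3 ≤ mm k ^ 3 := Nat.pow_le_pow_left hj 3
  have h3 : j ^ 2 ≤ j ^ 3 := by
    rcases Nat.eq_zero_or_pos j with rfl | h
    · simp
    · exact Nat.pow_le_pow_right h (by norm_num)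
  omega

lemma mm_sum {k : ℕ} (hk : 0 < k) : ∑ j ∈ Finset.Icc 1 (mm k), ((j : ℝ) ^ 2 / k) ≤ 1 / 10000 := by
  have hk' : (0 : ℝ) < k := by exact_mod_cast hk
  have h1 : (10000 : ℝ) * (mm k : ℝ) ^ 3 ≤ k := by exact_mod_cast mm_spec k
  have h2 : ∑ j ∈ Finset.Icc 1 (mm k), ((j : ℝ) ^ 2 / k) ≤
      (Finset.Icc 1 (mm k)).card • ((mm k : ℝ) ^ 2 / k) := by
    refine Finset.sum_le_card_nsmul _ _ _ fun j hj => ?_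
    have : (j : ℝ) ≤ mm k := by exact_mod_cast (Finset.mem_Icc.1 hj).2
    gcongr
  refine h2.trans ?_
  simp only [Nat.card_Icc, add_tsub_cancel_right, nsmul_eq_mul]
  rw [← mul_div_assoc, div_le_iff₀ hk']
  nlinarith

/-- Graphs whose small samples look like property `R'` with level `c`. -/
def lev (R' : GraphProp) (c : ℝ) : GraphProp := fun n =>
  {G | ∀ j, 1 ≤ j → j ≤ mm n → c ≤ frac (R' j) G}

lemma lev_prop (R' : GraphProp) (c : ℝ) : IsGraphProperty (lev R' c) := by
  rintro n G H ⟨e⟩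
  simp only [lev, Set.mem_ofPred_eq, frac_iso _ e]

lemma pick {n : ℕ} (hn : 0 < n) {U : ℝ → ℝ → ℝ} (hU : IsGraphon U) (R' : GraphProp)
    (hUR : ∀ k : ℕ, 1 ≤ k → (2 : ℝ) / 3 ≤ probIn k U R')
    {Y : (Fin n ⊕ Sym2 (Fin n) → ℝ) → ℝ} (hY : Integrable Y (SM n)) (hY0 : ∀ ω, 0 ≤ Y ω)
    (hYi : ∫ ω, Y ω ∂(SM n) ≤ 1 / 2) {p : (Fin n ⊕ Sym2 (Fin n) → ℝ) → Prop} (hp : ∀ᵐ ω ∂(SM n), p ω) :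
    ∃ ω, p ω ∧ Y ω < 1 ∧ gr U ω ∈ lev R' (3 / 5) n := by
  set D : ℕ → (Fin n ⊕ Sym2 (Fin n) → ℝ) → ℝ := fun j ω =>
    (frac (R' j) (gr U ω) - probIn j U R') ^ 2 with hD
  have hDi : ∀ j, Integrable (D j) (SM n) := fun j =>
    integrable_bdd (((frac_gr_measurable (R' j) hU).sub_const _).pow_const 2) 1 fun ω => by
      have := abs_sub_le_one (frac_mem (R' j) (gr U ω)) (probIn_mem (k := j) hU R')
      simp only [hD, abs_pow]
      exact pow_le_one₀ (abs_nonneg _) this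
  have hZi : Integrable (fun ω => ∑ j ∈ Finset.Icc 1 (mm n), D j ω) (SM n) :=
    integrable_finsetSum _ fun j _ => hDi j
  have hZ : ∫ ω, ∑ j ∈ Finset.Icc 1 (mm n), D j ω ∂(SM n) ≤ 8 / 10000 := by
    rw [integral_finsetSum _ fun j _ => hDi j]
    calc ∑ j ∈ Finset.Icc 1 (mm n), ∫ ω, D j ω ∂(SM n)
        ≤ ∑ j ∈ Finset.Icc 1 (mm n), 8 * ((j : ℝ) ^ 2 / n) := Finset.sum_le_sum fun j _ => by
          rw [← mul_div_assoc]; exact strat_variance hn hU R'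
      _ = 8 * ∑ j ∈ Finset.Icc 1 (mm n), ((j : ℝ) ^ 2 / n) := by rw [Finset.mul_sum]
      _ ≤ 8 / 10000 := by linarith [mm_sum hn]
  have hT : Integrable (fun ω => 225 * (∑ j ∈ Finset.Icc 1 (mm n), D j ω) + Y ω) (SM n) :=
    (hZi.const_mul 225).add hY
  obtain ⟨ω, hω, hle⟩ := exists_notMem_null_le_integral hT (N := {ω | ¬ p ω}) hp
  rw [integral_add (hZi.const_mul 225) hY, integral_const_mul] at hle
  have hD0 : ∀ j, 0 ≤ D j ω := fun j => sq_nonneg _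
  have hs0 : 0 ≤ ∑ j ∈ Finset.Icc 1 (mm n), D j ω := Finset.sum_nonneg fun j _ => hD0 j
  refine ⟨ω, by simpa using hω, by linarith, fun j h1 h2 => ?_⟩
  have hj : D j ω ≤ ∑ j ∈ Finset.Icc 1 (mm n), D j ω :=
    Finset.single_le_sum (fun j _ => hD0 j) (Finset.mem_Icc.2 ⟨h1, h2⟩)
  have hlt : D j ω < 1 / 225 := by linarith [hY0 ω]
  have h3 := hUR j h1
  by_contra hc
  push Not at hc
  simp only [hD] at hlt
  nlinarith

lemma testable_a (R' : GraphProp) {n k : ℕ} (G : SimpleGraph (Fin n)) (hG : G ∈ lev R' (3 / 5) n)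
    (hk : 1 ≤ k) (h : k ≤ n) : 2 * n.choose k ≤ 3 * goodCount G k (lev R' (1 / 2)) := by
  classical
  obtain ⟨c, hc, e1, e2⟩ := goodCount_perm h G _ (lev_prop R' (1 / 2))
  have hbad : ((Finset.univ.filter fun σ : Equiv.Perm (Fin n) => ¬ sub h G σ ∈ lev R' (1 / 2) k).card : ℝ)
      ≤ (n.factorial : ℝ) / 3 := by
    have hS : ∑ σ : Equiv.Perm (Fin n), ∑ j ∈ Finset.Icc 1 (mm k),
        100 * (frac (R' j) (sub h G σ) - frac (R' j) G) ^ 2 ≤ (n.factorial : ℝ) / 3 := by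
      rw [Finset.sum_comm]
      calc _ ≤ ∑ j ∈ Finset.Icc 1 (mm k), 100 * ((n.factorial : ℝ) * (16 * j ^ 2 / k)) := by
            refine Finset.sum_le_sum fun j hj => ?_
            rw [← Finset.mul_sum]
            have := sub_variance hk h (mm_sq (Finset.mem_Icc.1 hj).2) (R' j) G
            linarith
        _ = 1600 * n.factorial * ∑ j ∈ Finset.Icc 1 (mm k), ((j : ℝ) ^ 2 / k) := by
            rw [Finset.mul_sum]; refine Finset.sum_congr rfl fun j _ => ?_; ring
        _ ≤ 1600 * n.factorial * (1 / 10000) := by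
            have := mm_sum hk
            gcongr
        _ ≤ _ := by
            have : (0 : ℝ) ≤ n.factorial := by positivity
            linarith
    refine le_trans ?_ hS
    rw [← Finset.sum_boole]
    refine Finset.sum_le_sum fun σ _ => ?_
    have hnn : ∀ j ∈ Finset.Icc 1 (mm k), 0 ≤ 100 * (frac (R' j) (sub h G σ) - frac (R' j) G) ^ 2 :=
      fun j _ => by positivity
    split_ifs with hb
    · exact Finset.sum_nonneg hnn
    · simp only [lev, Set.mem_ofPred_eq] at hb
      push Not at hb
      obtain ⟨j, h1, h2, h3⟩ := hb
      have h4 : 3 / 5 ≤ frac (R' j) G := hG j h1 (h2.trans (mm_mono h))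
      refine le_trans ?_ (Finset.single_le_sum hnn (Finset.mem_Icc.2 ⟨h1, h2⟩))
      nlinarith
  have hsum : goodPerm h G (lev R' (1 / 2)) +
      (Finset.univ.filter fun σ : Equiv.Perm (Fin n) => ¬ sub h G σ ∈ lev R' (1 / 2) k).card = n.factorial := by
    have := Finset.card_filter_add_card_filter_not (s := (Finset.univ : Finset (Equiv.Perm (Fin n))))
      (fun σ : Equiv.Perm (Fin n) => sub h G σ ∈ lev R' (1 / 2) k)
    rw [Finset.card_univ, Fintype.card_perm, Fintype.card_fin] at this
    rw [← this]
    unfold goodPerm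
    congr!
  have hsum' : (goodPerm h G (lev R' (1 / 2)) : ℝ) +
      ((Finset.univ.filter fun σ : Equiv.Perm (Fin n) => ¬ sub h G σ ∈ lev R' (1 / 2) k).card : ℝ)
      = n.factorial := by exact_mod_cast hsum
  have hfin : 2 * (n.factorial : ℝ) ≤ 3 * goodPerm h G (lev R' (1 / 2)) := by linarith
  have hfin' : 2 * n.factorial ≤ 3 * goodPerm h G (lev R' (1 / 2)) := by exact_mod_cast hfin
  rw [e1, e2] at hfin'
  refine Nat.le_of_mul_le_mul_left ?_ hc
  linarith

lemma testable_b (R' : GraphProp) {n k j : ℕ} (G : SimpleGraph (Fin n)) (hj : 1 ≤ j)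
    (hjk : 10000 * j ^ 3 ≤ k) (h : k ≤ n) (hG : frac (R' j) G ≤ 1 / 3) :
    3 * goodCount G k (lev R' (1 / 2)) ≤ n.choose k := by
  classical
  obtain ⟨c, hc, e1, e2⟩ := goodCount_perm h G _ (lev_prop R' (1 / 2))
  have hjm := le_mm hjk
  have hk : 0 < k := by
    have : 0 < j ^ 3 := by positivity
    omega
  have hk' : (0 : ℝ) < k := by exact_mod_cast hk
  have hgood : (goodPerm h G (lev R' (1 / 2)) : ℝ) ≤ (n.factorial : ℝ) / 3 := by
    have hS : ∑ σ : Equiv.Perm (Fin n), 36 * (frac (R' j) (sub h G σ) - frac (R' j) G) ^ 2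
        ≤ (n.factorial : ℝ) / 3 := by
      rw [← Finset.mul_sum]
      have h1 := sub_variance hk h (mm_sq hjm) (R' j) G
      have h2 : (16 * (j : ℝ) ^ 2 / k) ≤ 1 / 108 := by
        rw [div_le_iff₀ hk']
        have h3 : (10000 : ℝ) * (j : ℝ) ^ 3 ≤ k := by exact_mod_cast hjk
        have h4 : (1 : ℝ) ≤ j := by exact_mod_cast hj
        have h5 : (j : ℝ) ^ 2 ≤ (j : ℝ) ^ 3 := pow_le_pow_right₀ h4 (by norm_num)
        nlinarith [sq_nonneg (j : ℝ)]
      have h3 : (n.factorial : ℝ) * (16 * j ^ 2 / k) ≤ n.factorial * (1 / 108) := by gcongr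
      linarith
    refine le_trans ?_ hS
    have : goodPerm h G (lev R' (1 / 2)) =
      (Finset.univ.filter fun σ : Equiv.Perm (Fin n) => sub h G σ ∈ lev R' (1 / 2) k).card := by
      unfold goodPerm; congr!
    rw [this, ← Finset.sum_boole]
    refine Finset.sum_le_sum fun σ _ => ?_
    split_ifs with hb
    · have h3 : 1 / 2 ≤ frac (R' j) (sub h G σ) := hb j hj hjm
      nlinarith
    · positivity
  have hfin : 3 * (goodPerm h G (lev R' (1 / 2)) : ℝ) ≤ n.factorial := by linarith
  have hfin' : 3 * goodPerm h G (lev R' (1 / 2)) ≤ n.factorial := by exact_mod_cast hfin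
  rw [e1, e2] at hfin'
  refine Nat.le_of_mul_le_mul_left ?_ hc
  linarith

lemma d1SetE_lt {W : ℝ → ℝ → ℝ} {R : Set (ℝ → ℝ → ℝ)} {ε : ℝ} (hε : 0 < ε)
    (h : ¬ ENNReal.ofReal ε ≤ d1SetE W R) : ∃ U ∈ R, l1Norm (fun x y => W x y - U x y) < ε := by
  rw [not_le, d1SetE] at h
  simp only [iInf_lt_iff] at h
  obtain ⟨U, hU, hlt⟩ := h
  exact ⟨U, hU, (ENNReal.ofReal_lt_ofReal_iff hε).1 hlt⟩

lemma graphD1_nonneg' {n : ℕ} (G H : SimpleGraph (Fin n)) : 0 ≤ graphD1 G H := by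
  unfold graphD1; positivity

lemma dist_transfer {R : Set (ℝ → ℝ → ℝ)} (hR : IsGraphonProperty R) (R' : GraphProp)
    (hR' : ∀ W ∈ R, ∀ k : ℕ, 1 ≤ k → (2 : ℝ) / 3 ≤ probIn k W R') {n : ℕ} (hn : 0 < n)
    (G : SimpleGraph (Fin n)) {ε : ℝ} (hε : 0 < ε)
    (h : ENNReal.ofReal ε ≤ graphD1P G (lev R' (3 / 5))) :
    ENNReal.ofReal ε ≤ d1SetE (graphonOf G) R := by
  by_contra hc
  obtain ⟨U, hU, hlt⟩ := d1SetE_lt hε hc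
  have hUg := hR.1 U hU
  obtain ⟨ω, -, h1, h2⟩ := pick hn hUg R' (hR' U hU)
    (Y := fun ω => graphD1 G (gr U ω) / ε) ((graphD1_gr_integrable hUg G).div_const ε)
    (fun ω => div_nonneg (graphD1_nonneg' _ _) hε.le)
    (by
      rw [integral_div, div_le_iff₀ hε]
      have := edit_expect hn hUg G
      linarith) (p := fun _ => True) (Eventually.of_forall fun _ => trivial)
  rw [div_lt_one hε] at h1
  have h3 : graphD1P G (lev R' (3 / 5)) ≤ ENNReal.ofReal (graphD1 G (gr U ω)) :=
    iInf₂_le (gr U ω) h2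
  have h4 := h.trans h3
  rw [ENNReal.ofReal_le_ofReal_iff (graphD1_nonneg' _ _)] at h4
  linarith

lemma closure_sub {R : Set (ℝ → ℝ → ℝ)} (hR : IsGraphonProperty R) (hclosed : CutClosed R) (R' : GraphProp)
    (hT : ∀ ε : ℝ, 0 < ε → ∃ kε : ℕ, 1 ≤ kε ∧ ∀ k, kε ≤ k → ∀ W, IsGraphon W →
      ENNReal.ofReal ε ≤ d1SetE W R → probIn k W R' ≤ 1 / 3) :
    closureP (lev R' (3 / 5)) ⊆ R := by
  rintro W ⟨hW, n, G, hG, hn, hδ⟩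
  have hp : ∀ j, 1 ≤ j → 3 / 5 ≤ probIn j W R' := by
    intro j hj
    obtain ⟨N, hN, h⟩ := probIn_delta j R'
    have hlim : Tendsto (fun m => probIn j W R' + N * deltaCut (graphonOf (G m)) W) atTop
        (nhds (probIn j W R' + N * 0)) := (hδ.const_mul N).const_add _
    rw [mul_zero, add_zero] at hlim
    refine ge_of_tendsto hlim ?_
    filter_upwards [hn.eventually_ge_atTop (10000 * j ^ 3)] with m hm
    have hpos : 0 < n m := by
      have : 0 < j ^ 3 := by positivity
      omega
    have h1 := h (graphonOf_isGraphon (G m)) hW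
    rw [probIn_graphonOf hpos] at h1
    exact le_trans (hG m j hj (le_mm hm)) h1
  refine hclosed W hW fun ε hε => ?_
  obtain ⟨k, hk1, hk⟩ := hT ε hε
  have : ¬ ENNReal.ofReal ε ≤ d1SetE W R := fun hc => by
    have h1 := hk k le_rfl W hW hc
    have h2 := hp k hk1
    linarith
  obtain ⟨U, hU, hlt⟩ := d1SetE_lt hε this
  exact ⟨U, hU, (cutNorm_le_l1 (hW.bm.sub (hR.1 U hU).bm)).trans_lt hlt⟩

lemma sub_closure {R : Set (ℝ → ℝ → ℝ)} (hR : IsGraphonProperty R) (R' : GraphProp)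
    (hR' : ∀ W ∈ R, ∀ k : ℕ, 1 ≤ k → (2 : ℝ) / 3 ≤ probIn k W R') :
    R ⊆ closureP (lev R' (3 / 5)) := by
  intro W hWR
  have hW := hR.1 W hWR
  have key : ∀ m : ℕ, ∃ n : ℕ, m ≤ n ∧ ∃ H : SimpleGraph (Fin n), H ∈ lev R' (3 / 5) n ∧
      cutNorm (fun x y => graphonOf H x y - W x y) ≤ 1 / ((m : ℝ) + 1) := by
    intro m
    obtain ⟨N, hN⟩ := cut_sample hW (show (0 : ℝ) < 1 / ((m : ℝ) + 1) by positivity)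
    have hpos : 0 < max N (m + 1) := lt_max_of_lt_right (Nat.succ_pos _)
    obtain ⟨Y, hY, hY0, hYi, hYc⟩ := hN (max N (m + 1)) (le_max_left _ _) hpos
    obtain ⟨ω, h1, h2, h3⟩ := pick hpos hW R' (hR' W hWR) hY hY0 (by linarith) hYc
    exact ⟨_, (Nat.le_succ m).trans (le_max_right _ _), gr W ω, h3, h1 h2⟩
  choose n hn H hH hcut using key
  refine ⟨hW, n, H, hH, tendsto_atTop_mono hn tendsto_id, ?_⟩
  exact squeeze_zero (fun m => deltaCut_nonneg _ _) (fun m => (deltaCut_le _ _).trans (hcut m))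
    tendsto_one_div_add_atTop_nhds_zero_nat

theorem exists_testable_graph_property_with_closure
    (R : Set (ℝ → ℝ → ℝ)) (hR : IsGraphonProperty R) (hclosed : CutClosed R)
    (hT : GraphonTestable R) :
    ∃ P : GraphProp, IsGraphProperty P ∧ GraphTestable P ∧ closureP P = R := by
  obtain ⟨R', -, h1, h2⟩ := hT
  refine ⟨lev R' (3 / 5), lev_prop _ _, ⟨lev R' (1 / 2), lev_prop _ _, ?_, ?_⟩,
    Set.Subset.antisymm (closure_sub hR hclosed R' h2) (sub_closure hR R' h1)⟩
  · intro n G hG k hk h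
    exact testable_a R' G hG hk h
  · intro ε hε
    obtain ⟨j, hj, hjε⟩ := h2 ε hε
    have hj3 : 0 < j ^ 3 := by positivity
    refine ⟨10000 * j ^ 3, by omega, fun n G k hk hkn hd => ?_⟩
    have hn : 0 < n := by omega
    have h3 := hjε j le_rfl _ (graphonOf_isGraphon G) (dist_transfer hR R' h1 hn G hε hd)
    rw [probIn_graphonOf hn] at h3
    exact testable_b R' G hj hk hkn h3

end
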